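/- Let X be a simplicial complex and S a set of labels, and let X^S be the complex whose simplices are simplices of X with vertices labeled by elements of S. If X is n-connected and the link of every k-simplex of X is (n − k − 1)-connected, then X^S is n-connected. Conversely, if X^S is n-connected then X is n-connected. -/

import Mathlib

open scoped BigOperators

structure ASC (V : Type) where
  faces : Set (Finset V)
  nonempty_of_mem : ∀ ⦃s⦄, s ∈ faces → s.Nonempty
  down_closed : ∀ ⦃s t : Finset V⦄, s ∈ faces → t ⊆ s → t.Nonempty → t ∈ faces

namespace ASC

variable {V W : Type} [DecidableEq V] [DecidableEq W]

/-- The geometric realization of an abstract simplicial complex, as a subset of `V → ℝ`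
(barycentric coordinates, with the product topology on the subtype). -/
def space (K : ASC V) : Set (V → ℝ) :=
  {x | (∀ v, 0 ≤ x v) ∧ ∃ s ∈ K.faces, (∀ v, v ∉ s → x v = 0) ∧ ∑ v ∈ s, x v = 1}

/-- A vertex map is simplicial if it sends faces to faces. -/
def IsSimplicial (K : ASC V) (L : ASC W) (φ : V → W) : Prop :=
  ∀ s ∈ K.faces, s.image φ ∈ L.faces

/-- The map induced on geometric realizations by a vertex map. -/
noncomputable def push (φ : V → W) (x : V → ℝ) : W → ℝ :=
  fun w => ∑ᶠ v ∈ φ ⁻¹' {w}, x v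

/-- The link of a simplex. -/
def link (K : ASC V) (σ : Finset V) : ASC V where
  faces := {t | t ∈ K.faces ∧ Disjoint σ t ∧ σ ∪ t ∈ K.faces}
  nonempty_of_mem := fun _ ht => K.nonempty_of_mem ht.1
  down_closed := by
    rintro t u ⟨h1, h2, h3⟩ hsub hne
    exact ⟨K.down_closed h1 hsub hne, h2.mono_right hsub,
      K.down_closed h3 (Finset.union_subset_union_right hsub)
        ⟨hne.choose, Finset.mem_union_right _ hne.choose_spec⟩⟩

end ASC

/-- `n`-connectedness of a space (`n` an integer): nonempty when `n ≥ -1`, and all homotopy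
groups in dimensions `≤ n` vanish, at every basepoint. -/
def IsConn (X : Type) [TopologicalSpace X] (n : ℤ) : Prop :=
  (-1 ≤ n → Nonempty X) ∧
    ∀ i : ℕ, (i : ℤ) ≤ n → ∀ x : X, Subsingleton (HomotopyGroup (Fin i) X x)


/-- The labeled complex `X^S`: simplices are simplices of `X` with vertices labeled by `S`,
encoded as finsets of pairs `(v, label)` projecting bijectively to a simplex of `X`. -/
def labeled {V : Type} [DecidableEq V] (K : ASC V) (S : Type) : ASC (V × S) where
  faces := {t | t.image Prod.fst ∈ K.faces ∧ ∀ p ∈ t, ∀ q ∈ t, Prod.fst p = Prod.fst q → p = q}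
  nonempty_of_mem := by
    intro t ht
    rcases K.nonempty_of_mem ht.1 with ⟨v, hv⟩
    rcases Finset.mem_image.mp hv with ⟨p, hp, _⟩
    exact ⟨p, hp⟩
  down_closed := by
    rintro t u ⟨h1, h2⟩ hsub hne
    exact ⟨K.down_closed h1 (Finset.image_subset_image hsub) (hne.image _),
      fun p hp q hq => h2 p (hsub hp) q (hsub hq)⟩

open Set Metric Topology

section Extension

variable {P Q E F : Type*} [TopologicalSpace P] [TopologicalSpace Q] [TopologicalSpace E]
  [TopologicalSpace F]

/-- Every map `d → X` that is continuous on `d` extends to a continuous map `c → X`. -/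
def ExtendsFrom (c d : Set P) (X : Set E) : Prop :=
  ∀ f : P → E, ContinuousOn f d → MapsTo f d X →
    ∃ g : P → E, ContinuousOn g c ∧ MapsTo g c X ∧ EqOn g f d

/-- Every map from the boundary of the `j`-dimensional cube to `X` extends to the cube. -/
def FillsSphere (j : ℕ) (X : Set E) : Prop :=
  ExtendsFrom (closedBall (0 : Fin j → ℝ) 1) (sphere 0 1) X

/-- The pair `(c, d)` is homeomorphic to the `j`-dimensional cube and its boundary. -/
structure IsCell (j : ℕ) (c d : Set P) : Prop where
  isClosed : IsClosed c
  isClosed_boundary : IsClosed d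
  boundary_subset : d ⊆ c
  exists_param : ∃ (φ : (Fin j → ℝ) → P) (ψ : P → (Fin j → ℝ)),
    ContinuousOn φ (closedBall 0 1) ∧ ContinuousOn ψ c ∧
    MapsTo φ (closedBall 0 1) c ∧ MapsTo ψ c (closedBall 0 1) ∧
    MapsTo φ (sphere 0 1) d ∧ MapsTo ψ d (sphere 0 1) ∧
    LeftInvOn φ ψ c ∧ LeftInvOn ψ φ (closedBall 0 1)

theorem ContinuousOn.exists_glue {s t : Set P} {f g : P → E} (hs : IsClosed s) (ht : IsClosed t)
    (hf : ContinuousOn f s) (hg : ContinuousOn g t) (h : EqOn f g (s ∩ t)) :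
    ∃ k : P → E, ContinuousOn k (s ∪ t) ∧ EqOn k f s ∧ EqOn k g t := by
  classical
  have h1 : EqOn (s.piecewise f g) f s := s.piecewise_eqOn f g
  have h2 : EqOn (s.piecewise f g) g t := by
    intro x hx
    by_cases hxs : x ∈ s
    · rw [h1 hxs, h ⟨hxs, hx⟩]
    · simp [hxs]
  exact ⟨_, (hf.congr h1).union_of_isClosed (hg.congr h2) hs ht, h1, h2⟩

theorem ExtendsFrom.transfer {c d : Set P} {c' d' : Set Q} {X : Set E} (h : ExtendsFrom c d X)
    {φ : P → Q} {ψ : Q → P} (hφ : ContinuousOn φ d) (hψ : ContinuousOn ψ c')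
    (hφd : MapsTo φ d d') (hψc : MapsTo ψ c' c) (hψd : MapsTo ψ d' d)
    (hφψ : LeftInvOn φ ψ d') : ExtendsFrom c' d' X := by
  intro f hf hfX
  obtain ⟨g, hg, hgX, hgf⟩ := h (f ∘ φ) (hf.comp hφ hφd) (hfX.comp hφd)
  refine ⟨g ∘ ψ, hg.comp hψ hψc, hgX.comp hψc, fun y hy => ?_⟩
  simp only [Function.comp_apply]
  rw [hgf (hψd hy), Function.comp_apply, hφψ hy]

namespace IsCell

variable {j : ℕ} {c d : Set P} {X : Set E}

theorem extendsFrom_iff (hc : IsCell j c d) : ExtendsFrom c d X ↔ FillsSphere j X := by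
  obtain ⟨φ, ψ, hφ, hψ, hφc, hψc, hφd, hψd, h1, h2⟩ := hc.exists_param
  exact ⟨fun h => h.transfer (hψ.mono hc.boundary_subset) hφ hψd hφc hφd
      (h2.mono sphere_subset_closedBall),
    fun h => ExtendsFrom.transfer h (hφ.mono sphere_subset_closedBall) hψ hφd hψc hψd
      (h1.mono hc.boundary_subset)⟩

theorem cube (j : ℕ) : IsCell j (closedBall (0 : Fin j → ℝ) 1) (sphere 0 1) :=
  ⟨isClosed_closedBall, isClosed_sphere, sphere_subset_closedBall, id, id, continuousOn_id,
    continuousOn_id, mapsTo_id _, mapsTo_id _, mapsTo_id _, mapsTo_id _,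
    fun _ _ => rfl, fun _ _ => rfl⟩

end IsCell

theorem mem_sphere_pi_iff {ι : Type*} [Fintype ι] {r : ℝ} (hr : 0 < r) {x : ι → ℝ} :
    x ∈ sphere (0 : ι → ℝ) r ↔ x ∈ closedBall (0 : ι → ℝ) r ∧ ∃ l, |x l| = r := by
  simp only [mem_sphere, mem_closedBall, dist_zero_right]
  constructor
  · intro h
    refine ⟨h.le, ?_⟩
    by_contra! hne
    have : ‖x‖ < r := (pi_norm_lt_iff hr).2 fun l =>
      lt_of_le_of_ne ((norm_le_pi_norm x l).trans h.le) (hne l)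
    exact this.ne h
  · rintro ⟨h, l, hl⟩
    exact le_antisymm h (hl ▸ norm_le_pi_norm x l)

/-- Radial projection from the point `(0, 2)` of a cylinder to its bottom and side. -/
theorem exists_retraction_cylinder (V : Type*) [NormedAddCommGroup V] [NormedSpace ℝ V] :
    ∃ r : V × ℝ → V × ℝ, ContinuousOn r (closedBall 0 1 ×ˢ Icc 0 1) ∧
      MapsTo r (closedBall 0 1 ×ˢ Icc 0 1) (closedBall 0 1 ×ˢ {0} ∪ sphere 0 1 ×ˢ Icc 0 1) ∧
      EqOn r id (closedBall 0 1 ×ˢ {0} ∪ sphere 0 1 ×ˢ Icc 0 1) := by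
  let s : V × ℝ → ℝ := fun p => max ‖p.1‖ (1 - p.2 / 2)
  have hs : ∀ p ∈ closedBall (0 : V) 1 ×ˢ Icc (0 : ℝ) 1, 0 < s p := by
    rintro ⟨x, t⟩ ⟨-, -, ht⟩
    refine lt_max_of_lt_right ?_
    dsimp at *
    linarith
  refine ⟨fun p => ((s p)⁻¹ • p.1, 2 - (2 - p.2) / s p), ?_, ?_, ?_⟩
  · have h1 : ContinuousOn s (closedBall 0 1 ×ˢ Icc 0 1) := by fun_prop
    have h2 : ∀ p ∈ closedBall (0 : V) 1 ×ˢ Icc (0 : ℝ) 1, s p ≠ 0 := fun p hp => (hs p hp).ne'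
    fun_prop (disch := assumption)
  · rintro ⟨x, t⟩ hp
    have hsp := hs _ hp
    obtain ⟨hx, ht0, ht1⟩ := hp
    simp only [mem_closedBall, dist_zero_right] at hx ht0 ht1
    rcases le_total ‖x‖ (1 - t / 2) with h | h
    · left
      have : s (x, t) = 1 - t / 2 := max_eq_right h
      rw [this] at hsp
      simp only [this, mem_prod, mem_closedBall, dist_zero_right, norm_smul, mem_singleton_iff,
        norm_inv, Real.norm_eq_abs, abs_of_pos hsp]
      constructor
      · rwa [inv_mul_le_iff₀ hsp, mul_one]
      · rw [show 2 - t = 2 * (1 - t / 2) by ring, mul_div_cancel_right₀ _ hsp.ne', sub_self]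
    · right
      have : s (x, t) = ‖x‖ := max_eq_left h
      rw [this] at hsp
      simp only [this, mem_prod, mem_sphere, dist_zero_right, norm_smul, norm_inv, norm_norm,
        mem_Icc, sub_nonneg]
      refine ⟨inv_mul_cancel₀ hsp.ne', ?_, ?_⟩
      · rw [div_le_iff₀ hsp]
        linarith
      · have : 2 - t ≤ (2 - t) / ‖x‖ := by
          rw [le_div_iff₀ hsp]
          nlinarith
        linarith
  · rintro ⟨x, t⟩ hp
    have : s (x, t) = 1 := by
      rcases hp with ⟨hx, ht⟩ | ⟨hx, ht⟩
      · simp only [mem_closedBall, dist_zero_right, mem_singleton_iff] at hx ht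
        simp [s, ht, hx]
      · simp only [mem_sphere, dist_zero_right, mem_Icc] at hx ht
        simp only [s, hx]
        exact max_eq_left (by linarith)
    simp [this]

namespace IsCell

variable {j : ℕ} {c d : Set P} {X : Set E}

/-- The homotopy extension property of a cell relative to its boundary. -/
theorem extendsFrom_cylinder (hc : IsCell j c d) (X : Set E) :
    ExtendsFrom (c ×ˢ Icc (0 : ℝ) 1) (c ×ˢ {0} ∪ d ×ˢ Icc 0 1) X := by
  obtain ⟨φ, ψ, hφ, hψ, hφc, hψc, hφd, hψd, h1, h2⟩ := hc.exists_param
  obtain ⟨r, hr, hrm, hri⟩ := exists_retraction_cylinder (Fin j → ℝ)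
  have hsub : closedBall (0 : Fin j → ℝ) 1 ×ˢ {0} ∪ sphere 0 1 ×ˢ Icc 0 1 ⊆
      closedBall (0 : Fin j → ℝ) 1 ×ˢ Icc (0 : ℝ) 1 :=
    union_subset (prod_mono_right (by simp)) (prod_mono_left sphere_subset_closedBall)
  have hcube : ExtendsFrom (closedBall (0 : Fin j → ℝ) 1 ×ˢ Icc (0 : ℝ) 1)
      (closedBall 0 1 ×ˢ {0} ∪ sphere 0 1 ×ˢ Icc 0 1) X := fun f hf hfX =>
    ⟨f ∘ r, hf.comp hr hrm, hfX.comp hrm, fun p hp => congrArg f (hri hp)⟩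
  have hsub' : c ×ˢ {0} ∪ d ×ˢ Icc 0 1 ⊆ c ×ˢ Icc (0 : ℝ) 1 :=
    union_subset (prod_mono_right (by simp)) (prod_mono_left hc.boundary_subset)
  refine hcube.transfer (φ := Prod.map φ id) (ψ := Prod.map ψ id)
    ((hφ.prodMap continuousOn_id).mono hsub) (hψ.prodMap continuousOn_id)
    ?_ (hψc.prodMap (mapsTo_id _)) ?_ ?_
  · rintro ⟨x, t⟩ (⟨hx, ht⟩ | ⟨hx, ht⟩)
    exacts [Or.inl ⟨hφc hx, ht⟩, Or.inr ⟨hφd hx, ht⟩]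
  · rintro ⟨x, t⟩ (⟨hx, ht⟩ | ⟨hx, ht⟩)
    exacts [Or.inl ⟨hψc hx, ht⟩, Or.inr ⟨hψd hx, ht⟩]
  · rintro ⟨x, t⟩ h
    exact Prod.ext (h1 (hsub' h).1) rfl

theorem cylinder (hc : IsCell j c d) :
    IsCell (j + 1) (c ×ˢ Icc (0 : ℝ) 1) (c ×ˢ {0, 1} ∪ d ×ˢ Icc 0 1) := by
  obtain ⟨φ, ψ, hφ, hψ, hφc, hψc, hφd, hψd, h1, h2⟩ := hc.exists_param
  have hball : ∀ x : Fin (j + 1) → ℝ, x ∈ closedBall (0 : Fin (j + 1) → ℝ) 1 ↔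
      |x 0| ≤ 1 ∧ Fin.tail x ∈ closedBall (0 : Fin j → ℝ) 1 := by
    intro x
    simp [pi_norm_le_iff_of_nonneg, Fin.forall_fin_succ, Fin.tail]
  have htail : Continuous (Fin.tail : (Fin (j + 1) → ℝ) → (Fin j → ℝ)) := by
    unfold Fin.tail
    fun_prop
  refine ⟨hc.isClosed.prod isClosed_Icc,
    (hc.isClosed.prod (Set.toFinite _).isClosed).union (hc.isClosed_boundary.prod isClosed_Icc),
    union_subset (prod_mono_right (by simp [insert_subset_iff]))
      (prod_mono_left hc.boundary_subset),
    fun x => (φ (Fin.tail x), (x 0 + 1) / 2), fun p => Fin.cons (2 * p.2 - 1) (ψ p.1),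
    ?_, ?_, ?_, ?_, ?_, ?_, ?_, ?_⟩
  · refine ContinuousOn.prodMk (hφ.comp htail.continuousOn fun x hx => ((hball x).1 hx).2) ?_
    fun_prop
  · have h3 : ContinuousOn (fun p : P × ℝ => ψ p.1) (c ×ˢ Icc (0 : ℝ) 1) :=
      hψ.comp continuousOn_fst fun p hp => hp.1
    rw [continuousOn_pi]
    intro l
    refine Fin.cases ?_ (fun l => ?_) l
    · simp only [Fin.cons_zero]
      fun_prop
    · simp only [Fin.cons_succ]
      exact (continuousOn_pi.1 h3) l
  · intro x hx
    obtain ⟨h3, h4⟩ := (hball x).1 hx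
    rw [abs_le] at h3
    exact ⟨hφc h4, by dsimp; constructor <;> linarith⟩
  · rintro ⟨x, t⟩ ⟨hx, ht0, ht1⟩
    rw [hball]
    dsimp at ht0 ht1
    refine ⟨?_, by simpa using hψc hx⟩
    dsimp only
    rw [Fin.cons_zero, abs_le]
    constructor <;> linarith
  · intro x hx
    obtain ⟨h3, l, hl⟩ := (mem_sphere_pi_iff one_pos).1 hx
    obtain ⟨h3, h4⟩ := (hball x).1 h3
    revert hl
    refine Fin.cases (fun hl => ?_) (fun l hl => ?_) l
    · left
      refine ⟨hφc h4, ?_⟩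
      rcases (abs_eq one_pos.le).1 hl with h | h <;> simp [h]
    · right
      rw [abs_le] at h3
      exact ⟨hφd ((mem_sphere_pi_iff one_pos).2 ⟨h4, l, hl⟩), by dsimp; constructor <;> linarith⟩
  · rintro ⟨x, t⟩ hp
    rw [mem_sphere_pi_iff one_pos, hball]
    simp only [Fin.cons_zero, Fin.tail_cons]
    rcases hp with ⟨hx, ht⟩ | ⟨hx, ht0, ht1⟩
    · have : |2 * t - 1| = 1 := by
        rcases ht with rfl | rfl <;> norm_num
      exact ⟨⟨this.le, hψc hx⟩, 0, this⟩
    · obtain ⟨h3, l, hl⟩ := (mem_sphere_pi_iff one_pos).1 (hψd hx)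
      dsimp at *
      refine ⟨⟨?_, h3⟩, l.succ, by simpa using hl⟩
      rw [abs_le]
      constructor <;> linarith
  · rintro ⟨x, t⟩ hp
    simp [h1 hp.1]
  · intro x hx
    simp only [h2 ((hball x).1 hx).2]
    rw [show 2 * ((x 0 + 1) / 2) - 1 = x 0 by ring, Fin.cons_self_tail]

/-- Whether a map on the boundary of a cell extends to the cell is invariant under homotopy. -/
theorem exists_extension_of_homotopy (hc : IsCell j c d) {f g : P → E} {H : P × ℝ → E}
    (hH : ContinuousOn H (d ×ˢ Icc 0 1)) (hHX : MapsTo H (d ×ˢ Icc 0 1) X)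
    (hH0 : ∀ y ∈ d, H (y, 0) = f y) (hH1 : ∀ y ∈ d, H (y, 1) = g y)
    (hg : ContinuousOn g c) (hgX : MapsTo g c X) :
    ∃ k : P → E, ContinuousOn k c ∧ MapsTo k c X ∧ EqOn k f d := by
  have hrev : MapsTo (fun p : P × ℝ => (p.1, 1 - p.2)) (d ×ˢ Icc 0 1) (d ×ˢ Icc 0 1) := by
    rintro ⟨y, t⟩ ⟨hy, ht0, ht1⟩
    dsimp at *
    exact ⟨hy, by constructor <;> dsimp <;> linarith⟩
  obtain ⟨F, hF, hFg, hFH⟩ := ContinuousOn.exists_glue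
    (hc.isClosed.prod (isClosed_singleton (x := (0 : ℝ)))) (hc.isClosed_boundary.prod isClosed_Icc)
    (f := fun p : P × ℝ => g p.1) (g := fun p : P × ℝ => H (p.1, 1 - p.2))
    (hg.comp continuousOn_fst fun p hp => hp.1)
    (hH.comp (by fun_prop) hrev)
    (by
      rintro ⟨y, t⟩ ⟨⟨-, ht⟩, ⟨hy, -⟩⟩
      obtain rfl : t = 0 := ht
      simp [hH1 y hy])
  obtain ⟨G, hG, hGX, hGF⟩ := hc.extendsFrom_cylinder X F hF (by
    rintro p (hp | hp)
    · rw [hFg hp]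
      exact hgX hp.1
    · rw [hFH hp]
      exact hHX (hrev hp))
  have hin : MapsTo (fun y : P => (y, (1 : ℝ))) c (c ×ˢ Icc 0 1) := fun y hy => ⟨hy, by simp⟩
  refine ⟨fun y => G (y, 1), hG.comp (by fun_prop) hin, hGX.comp hin, fun y hy => ?_⟩
  have hy1 : (y, (1 : ℝ)) ∈ d ×ˢ Icc (0 : ℝ) 1 := ⟨hy, by simp⟩
  simp only
  rw [hGF (Or.inr hy1), hFH hy1]
  simp [hH0 y hy]

end IsCell

theorem FillsSphere.of_dominated {j : ℕ} {X : Set E} {Y : Set F} (hY : FillsSphere j Y)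
    {i : E → F} {r : F → E} (hi : ContinuousOn i X) (hr : ContinuousOn r Y)
    (hiY : MapsTo i X Y) (hrX : MapsTo r Y X) {H : E × ℝ → E}
    (hH : ContinuousOn H (X ×ˢ Icc 0 1)) (hHX : MapsTo H (X ×ˢ Icc 0 1) X)
    (hH0 : ∀ x ∈ X, H (x, 0) = x) (hH1 : ∀ x ∈ X, H (x, 1) = r (i x)) : FillsSphere j X := by
  intro f hf hfX
  obtain ⟨g, hg, hgY, hgf⟩ := hY (i ∘ f) (hi.comp hf hfX) (hiY.comp hfX)
  have hm : MapsTo (Prod.map f id) (sphere 0 1 ×ˢ Icc (0 : ℝ) 1) (X ×ˢ Icc 0 1) :=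
    hfX.prodMap (mapsTo_id _)
  refine (IsCell.cube j).exists_extension_of_homotopy (H := H ∘ Prod.map f id)
    (hH.comp (hf.prodMap continuousOn_id) hm) (hHX.comp hm) (fun y hy => hH0 _ (hfX hy))
    (fun y hy => ?_) (hr.comp hg hgY) (hrX.comp hgY)
  simp [hH1 _ (hfX hy), hgf hy]

theorem FillsSphere.of_retract {j : ℕ} {X : Set E} {Y : Set F} (hY : FillsSphere j Y)
    {i : E → F} {r : F → E} (hi : ContinuousOn i X) (hr : ContinuousOn r Y)
    (hiY : MapsTo i X Y) (hrX : MapsTo r Y X) (hri : LeftInvOn r i X) : FillsSphere j X :=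
  hY.of_dominated hi hr hiY hrX (H := Prod.fst) continuousOn_fst (fun _ hp => hp.1)
    (fun _ _ => rfl) fun _ hx => (hri hx).symm

theorem fillsSphere_zero_iff [Nonempty E] {X : Set E} : FillsSphere 0 X ↔ X.Nonempty := by
  have hs : sphere (0 : Fin 0 → ℝ) 1 = ∅ := sphere_eq_empty_of_subsingleton one_ne_zero
  simp only [FillsSphere, ExtendsFrom, hs]
  constructor
  · intro h
    obtain ⟨g, -, hg, -⟩ := h (fun _ => Classical.arbitrary E) (continuousOn_empty _)
      (mapsTo_empty _ _)
    exact ⟨g 0, hg (mem_closedBall_self zero_le_one)⟩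
  · rintro ⟨x, hx⟩ f - -
    exact ⟨fun _ => x, continuousOn_const, fun _ _ => hx, eqOn_empty _ _⟩

end Extension

section Grid

variable {ι E : Type*} [TopologicalSpace E]

/-- The closed cell with centre `p` of the cubical grid in `ℝ^ι` with vertex set `(2ℤ)^ι`. Its
free coordinates are those in which `p` is odd. -/
def gridCell (p : ι → ℤ) : Set (ι → ℝ) :=
  {y | ∀ k, |y k - p k| ≤ 1 ∧ (Even (p k) → y k = p k)}

/-- The boundary of a grid cell. -/
def gridBoundary (p : ι → ℤ) : Set (ι → ℝ) :=
  {y | y ∈ gridCell p ∧ ∃ k, Odd (p k) ∧ |y k - p k| = 1}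

/-- The face relation between grid cells. -/
def IsGridFace (q p : ι → ℤ) : Prop :=
  ∀ k, q k = p k ∨ Odd (p k) ∧ |q k - p k| = 1

theorem IsGridFace.gridCell_subset {q p : ι → ℤ} (h : IsGridFace q p) :
    gridCell q ⊆ gridCell p := by
  intro y hy k
  obtain ⟨h1, h2⟩ := hy k
  rcases h k with h3 | ⟨h3, h4⟩
  · rw [← h3]
    exact ⟨h1, h2⟩
  · have h5 : Even (q k) := by
      rcases (abs_eq zero_le_one).1 h4 with h | h <;> grind
    rw [h2 h5]
    refine ⟨by exact_mod_cast h4.le, fun h6 => ?_⟩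
    grind

theorem IsGridFace.eq_of_ncard_le [Finite ι] {q p : ι → ℤ} (h : IsGridFace q p)
    (hdim : {k | Odd (p k)}.ncard ≤ {k | Odd (q k)}.ncard) : q = p := by
  have hodd : ∀ k, Odd (q k) → q k = p k := by
    intro k hk
    refine (h k).resolve_right ?_
    rintro ⟨h1, h2⟩
    rcases (abs_eq zero_le_one).1 h2 with h | h <;> grind
  have hsub : {k | Odd (q k)} ⊆ {k | Odd (p k)} := fun k hk => by
    simpa [← hodd k hk] using hk
  have heq := Set.eq_of_subset_of_ncard_le hsub hdim
  refine funext fun k => (h k).elim id fun hk => hodd k ?_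
  have : k ∈ {k | Odd (q k)} := heq ▸ hk.1
  exact this

theorem isClosed_gridCell (p : ι → ℤ) : IsClosed (gridCell p) := by
  simp only [gridCell, ofPred_forall, ofPred_and]
  refine isClosed_iInter fun k => IsClosed.inter (isClosed_le (by fun_prop) (by fun_prop)) ?_
  by_cases h : Even (p k)
  · simpa [h] using isClosed_eq (by fun_prop) (by fun_prop)
  · simp [h]

theorem isClosed_gridBoundary [Finite ι] (p : ι → ℤ) : IsClosed (gridBoundary p) := by
  have : gridBoundary p = gridCell p ∩ ⋃ k, {y | Odd (p k) ∧ |y k - p k| = 1} := by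
    ext y
    simp [gridBoundary]
  rw [this]
  refine (isClosed_gridCell p).inter (isClosed_iUnion_of_finite fun k => ?_)
  by_cases h : Odd (p k)
  · simpa [h] using isClosed_eq (by fun_prop) (by fun_prop)
  · simp [h]

theorem exists_isGridFace_of_mem_gridBoundary {p : ι → ℤ} {y : ι → ℝ} (hy : y ∈ gridBoundary p) :
    ∃ q, IsGridFace q p ∧ q ≠ p ∧ y ∈ gridCell q := by
  classical
  obtain ⟨hy, k, hk, hyk⟩ := hy
  obtain ⟨e, he, hye⟩ : ∃ e : ℤ, |e| = 1 ∧ y k = p k + e := by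
    rcases (abs_eq zero_le_one).1 hyk with h | h
    · exact ⟨1, by simp, by push_cast; linarith⟩
    · exact ⟨-1, by simp, by push_cast; linarith⟩
  refine ⟨Function.update p k (p k + e), fun l => ?_, fun h => ?_, fun l => ?_⟩
  · rcases eq_or_ne l k with rfl | hl
    · right
      simpa using ⟨hk, he⟩
    · left
      simp [hl]
  · have := congrFun h k
    simp only [Function.update_self, add_eq_left] at this
    simp [this] at he
  · rcases eq_or_ne l k with rfl | hl
    · simp [hye]
    · simpa [hl] using hy l

theorem mem_gridBoundary_of_mem {p q : ι → ℤ} [Fintype ι] {y : ι → ℝ} (hp : y ∈ gridCell p)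
    (hq : y ∈ gridCell q) (hpq : q ≠ p)
    (hdim : {k | Odd (q k)}.ncard ≤ {k | Odd (p k)}.ncard) : y ∈ gridBoundary p := by
  by_contra hb
  have hlt : ∀ k, Odd (p k) → |y k - p k| < 1 := fun k hk =>
    lt_of_le_of_ne (hp k).1 fun h => hb ⟨hp, k, hk, h⟩
  have hodd : ∀ k, Odd (p k) → q k = p k := by
    intro k hk
    have h1 := abs_lt.1 (hlt k hk)
    have h2 : Odd (q k) := by
      by_contra h
      rw [Int.not_odd_iff_even] at h
      rw [(hq k).2 h] at h1
      have h3 : -1 < q k - p k := by exact_mod_cast h1.1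
      have h4 : q k - p k < 1 := by exact_mod_cast h1.2
      grind
    have h3 := abs_le.1 (hq k).1
    have h4 : -2 < q k - p k := by
      have : (-2 : ℝ) < q k - p k := by linarith
      exact_mod_cast this
    have h5 : q k - p k < 2 := by
      have : (q k - p k : ℝ) < 2 := by linarith
      exact_mod_cast this
    grind
  have hsub : {k | Odd (p k)} ⊆ {k | Odd (q k)} := fun k hk => by
    simpa [hodd k hk] using hk
  have heq := Set.eq_of_subset_of_ncard_le hsub hdim
  refine hpq (funext fun k => ?_)
  by_cases hk : Odd (p k)
  · exact hodd k hk
  · have hk' : ¬ Odd (q k) := fun h => hk (by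
      have : k ∈ {k | Odd (p k)} := heq ▸ h
      exact this)
    rw [Int.not_odd_iff_even] at hk hk'
    have := (hp k).2 hk
    rw [(hq k).2 hk'] at this
    exact_mod_cast this

theorem isCell_gridCell [Fintype ι] (p : ι → ℤ) :
    IsCell {k | Odd (p k)}.ncard (gridCell p) (gridBoundary p) := by
  classical
  let e : {k // Odd (p k)} ≃ Fin {k | Odd (p k)}.ncard := Finite.equivFin _
  refine ⟨isClosed_gridCell p, isClosed_gridBoundary p, fun y hy => hy.1,
    fun z k => if h : Odd (p k) then p k + z (e ⟨k, h⟩) else p k,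
    fun y l => y (e.symm l) - p (e.symm l), ?_, ?_, ?_, ?_, ?_, ?_, ?_, ?_⟩
  · refine Continuous.continuousOn (continuous_pi fun k => ?_)
    split_ifs <;> fun_prop
  · fun_prop
  · intro z hz k
    simp only [mem_closedBall, dist_zero_right, pi_norm_le_iff_of_nonneg zero_le_one] at hz
    dsimp only
    split_ifs with h
    · exact ⟨by simpa using hz _, fun h' => by grind⟩
    · simp
  · intro y hy
    simp only [mem_closedBall, dist_zero_right, pi_norm_le_iff_of_nonneg zero_le_one]
    exact fun l => (hy _).1
  · intro z hz
    obtain ⟨hz, l, hl⟩ := (mem_sphere_pi_iff one_pos).1 hz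
    simp only [mem_closedBall, dist_zero_right, pi_norm_le_iff_of_nonneg zero_le_one] at hz
    refine ⟨fun k => ?_, e.symm l, (e.symm l).2, ?_⟩
    · dsimp only
      split_ifs with h
      · exact ⟨by simpa using hz _, fun h' => by grind⟩
      · simp
    · simp [(e.symm l).2, hl]
  · rintro y ⟨hy, k, hk, hyk⟩
    rw [mem_sphere_pi_iff one_pos]
    simp only [mem_closedBall, dist_zero_right, pi_norm_le_iff_of_nonneg zero_le_one]
    exact ⟨fun l => (hy _).1, e ⟨k, hk⟩, by simpa using hyk⟩
  · intro y hy
    funext k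
    by_cases h : Odd (p k)
    · simp [h]
    · simp [h, (hy k).2 (Int.not_odd_iff_even.1 h)]
  · intro z hz
    funext l
    simp [(e.symm l).2]

theorem IsCell.exists_compression {P : Type*} [TopologicalSpace P] {j : ℕ} {c d : Set P}
    (hc : IsCell j c d) {A B : Set E} (hA : FillsSphere (j + 1) A) (hAB : FillsSphere j (A ∩ B))
    {f : P → E} (hf : ContinuousOn f c) (hfc : MapsTo f c A ∨ MapsTo f c B)
    {H : P × ℝ → E} (hH : ContinuousOn H (d ×ˢ Icc 0 1)) (hH0 : ∀ y ∈ d, H (y, 0) = f y)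
    (hH1 : ∀ y ∈ d, H (y, 1) ∈ B) (hHA : MapsTo f c A → MapsTo H (d ×ˢ Icc 0 1) A)
    (hHB : MapsTo f c B → MapsTo H (d ×ˢ Icc 0 1) B) :
    ∃ G : P × ℝ → E, ContinuousOn G (c ×ˢ Icc 0 1) ∧ EqOn G H (d ×ˢ Icc 0 1) ∧
      (∀ y ∈ c, G (y, 0) = f y) ∧ (∀ y ∈ c, G (y, 1) ∈ B) ∧
      (MapsTo f c A → MapsTo G (c ×ˢ Icc 0 1) A) ∧
      (MapsTo f c B → MapsTo G (c ×ˢ Icc 0 1) B) := by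
  have hbot : ContinuousOn (fun p : P × ℝ => f p.1) (c ×ˢ {0}) :=
    hf.comp continuousOn_fst fun p hp => hp.1
  obtain ⟨K, hK, hKf, hKH⟩ := ContinuousOn.exists_glue
    (hc.isClosed.prod (isClosed_singleton (x := (0 : ℝ)))) (hc.isClosed_boundary.prod isClosed_Icc)
    hbot hH (by
      rintro ⟨y, t⟩ ⟨⟨-, ht⟩, ⟨hy, -⟩⟩
      obtain rfl : t = 0 := ht
      exact (hH0 y hy).symm)
  by_cases hB : MapsTo f c B
  · let Z : Set E := {x | x ∈ B ∧ (MapsTo f c A → x ∈ A)}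
    have hKZ : MapsTo K (c ×ˢ {0} ∪ d ×ˢ Icc 0 1) Z := by
      rintro p (hp | hp)
      · rw [hKf hp]
        exact ⟨hB hp.1, fun h => h hp.1⟩
      · rw [hKH hp]
        exact ⟨hHB hB hp, fun h => hHA h hp⟩
    obtain ⟨G, hG, hGZ, hGK⟩ := hc.extendsFrom_cylinder Z K hK hKZ
    exact ⟨G, hG, fun p hp => (hGK (Or.inr hp)).trans (hKH hp),
      fun y hy => (hGK (Or.inl ⟨hy, mem_singleton _⟩)).trans (hKf ⟨hy, mem_singleton _⟩),
      fun y hy => (hGZ (x := (y, 1)) ⟨hy, by simp⟩).1, fun h p hp => (hGZ hp).2 h,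
      fun _ p hp => (hGZ hp).1⟩
  · have hfA := hfc.resolve_right hB
    have hin : MapsTo (fun y : P => (y, (1 : ℝ))) d (d ×ˢ Icc 0 1) := fun y hy => ⟨hy, by simp⟩
    obtain ⟨g, hg, hgAB, hgH⟩ := hc.extendsFrom_iff.2 hAB (fun y => H (y, 1))
      (hH.comp (by fun_prop) hin) fun y hy => ⟨hHA hfA (hin hy), hH1 y hy⟩
    have hclosed := (hc.isClosed.prod (isClosed_singleton (x := (0 : ℝ)))).union
      (hc.isClosed_boundary.prod (isClosed_Icc (a := (0 : ℝ)) (b := 1)))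
    obtain ⟨L, hL, hLK, hLg⟩ := ContinuousOn.exists_glue hclosed
      (hc.isClosed.prod (isClosed_singleton (x := (1 : ℝ)))) hK
      (g := fun p : P × ℝ => g p.1) (hg.comp continuousOn_fst fun p hp => hp.1) (by
        rintro ⟨y, t⟩ ⟨h, ⟨hy, ht⟩⟩
        obtain rfl : t = 1 := ht
        rcases h with ⟨-, ht⟩ | h
        · simp at ht
        · rw [hKH h]
          exact (hgH h.1).symm)
    have hset : c ×ˢ {0, 1} ∪ d ×ˢ Icc 0 1 = (c ×ˢ {0} ∪ d ×ˢ Icc (0 : ℝ) 1) ∪ c ×ˢ {1} := by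
      rw [← singleton_union, prod_union, union_right_comm]
    obtain ⟨G, hG, hGA, hGL⟩ := hc.cylinder.extendsFrom_iff.2 hA L (hset ▸ hL) (by
      rw [hset]
      rintro p ((hp | hp) | hp)
      · rw [hLK (Or.inl hp), hKf hp]
        exact hfA hp.1
      · rw [hLK (Or.inr hp), hKH hp]
        exact hHA hfA hp
      · rw [hLg hp]
        exact (hgAB hp.1).1)
    rw [hset] at hGL
    refine ⟨G, hG, fun p hp => ?_, fun y hy => ?_, fun y hy => ?_, fun _ => hGA,
      fun h => absurd h hB⟩
    · rw [hGL (Or.inl (Or.inr hp)), hLK (Or.inr hp), hKH hp]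
    · have h0 : (y, (0 : ℝ)) ∈ c ×ˢ {(0 : ℝ)} := ⟨hy, rfl⟩
      rw [hGL (Or.inl (Or.inl h0)), hLK (Or.inl h0), hKf h0]
    · have h1 : (y, (1 : ℝ)) ∈ c ×ˢ {(1 : ℝ)} := ⟨hy, rfl⟩
      rw [hGL (Or.inr h1), hLg h1]
      exact (hgAB hy).2

/-- A map from a finite cubical complex to `A ∪ B`, all of whose cells land in `A` or in `B`,
can be deformed into `B`, one cell after the other, if `A` and `A ∩ B` are highly connected. -/
theorem exists_grid_compression [Fintype ι] {A B : Set E} (hA : ∀ j, FillsSphere j A)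
    {f : (ι → ℝ) → E} (D : Finset (ι → ℤ)) (hD : ∀ p ∈ D, ∀ q, IsGridFace q p → q ∈ D)
    (hf : ContinuousOn f (⋃ p ∈ D, gridCell p))
    (hfAB : ∀ p ∈ D, MapsTo f (gridCell p) A ∨ MapsTo f (gridCell p) B)
    (hAB : ∀ p ∈ D, FillsSphere {k | Odd (p k)}.ncard (A ∩ B)) :
    ∃ H : (ι → ℝ) × ℝ → E, ContinuousOn H ((⋃ p ∈ D, gridCell p) ×ˢ Icc 0 1) ∧
      (∀ y ∈ ⋃ p ∈ D, gridCell p, H (y, 0) = f y) ∧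
      (∀ y ∈ ⋃ p ∈ D, gridCell p, H (y, 1) ∈ B) ∧
      ∀ p ∈ D, (MapsTo f (gridCell p) A → MapsTo H (gridCell p ×ˢ Icc 0 1) A) ∧
        (MapsTo f (gridCell p) B → MapsTo H (gridCell p ×ˢ Icc 0 1) B) := by
  classical
  induction hn : D.card generalizing D with
  | zero =>
    obtain rfl := Finset.card_eq_zero.1 hn
    exact ⟨fun p => f p.1, by simp, by simp, by simp, by simp⟩
  | succ n ih =>
    obtain ⟨p, hp, hmax⟩ := D.exists_max_image (fun p => {k | Odd (p k)}.ncard)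
      (Finset.card_pos.1 (by omega))
    set U : Set (ι → ℝ) := ⋃ q ∈ D.erase p, gridCell q with hU
    have hUD : ⋃ q ∈ D, gridCell q = U ∪ gridCell p := by
      conv_lhs => rw [← Finset.insert_erase hp]
      rw [Finset.set_biUnion_insert, union_comm]
    have hUp : U ∩ gridCell p ⊆ gridBoundary p := by
      rintro y ⟨hy, hyp⟩
      simp only [hU, mem_iUnion] at hy
      obtain ⟨q, hq, hyq⟩ := hy
      rw [Finset.mem_erase] at hq
      exact mem_gridBoundary_of_mem hyp hyq hq.1 (hmax q hq.2)
    have hface : ∀ y ∈ gridBoundary p, ∃ q ∈ D.erase p, IsGridFace q p ∧ y ∈ gridCell q := by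
      intro y hy
      obtain ⟨q, hqp, hne, hyq⟩ := exists_isGridFace_of_mem_gridBoundary hy
      exact ⟨q, Finset.mem_erase.2 ⟨hne, hD p hp q hqp⟩, hqp, hyq⟩
    have hbU : gridBoundary p ⊆ U := by
      intro y hy
      obtain ⟨q, hq, -, hyq⟩ := hface y hy
      exact mem_biUnion hq hyq
    have hUclosed : IsClosed U :=
      (D.erase p).finite_toSet.isClosed_biUnion fun q _ => isClosed_gridCell q
    rw [hUD] at hf ⊢
    obtain ⟨H, hH, hH0, hH1, hHc⟩ := ih (D.erase p)
      (fun q hq r hr => by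
        rw [Finset.mem_erase] at hq ⊢
        refine ⟨?_, hD q hq.2 r hr⟩
        rintro rfl
        exact hq.1 (hr.eq_of_ncard_le (hmax q hq.2)).symm)
      (hf.mono subset_union_left)
      (fun q hq => hfAB q (Finset.mem_of_mem_erase hq))
      (fun q hq => hAB q (Finset.mem_of_mem_erase hq))
      (by rw [Finset.card_erase_of_mem hp, hn]; rfl)
    rw [← hU] at hH hH0 hH1
    have hcarrier : ∀ Z : Set E, (∀ q ∈ D.erase p, MapsTo f (gridCell q) Z →
        MapsTo H (gridCell q ×ˢ Icc 0 1) Z) → MapsTo f (gridCell p) Z →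
        MapsTo H (gridBoundary p ×ˢ Icc 0 1) Z := by
      rintro Z hZ hfZ ⟨y, t⟩ ⟨hy, ht⟩
      obtain ⟨q, hq, hqp, hyq⟩ := hface y hy
      exact hZ q hq (hfZ.mono_left hqp.gridCell_subset) ⟨hyq, ht⟩
    obtain ⟨G, hG, hGH, hG0, hG1, hGA, hGB⟩ := (isCell_gridCell p).exists_compression
      (hA _) (hAB p hp) (hf.mono subset_union_right) (hfAB p hp)
      (hH.mono (prod_mono_left hbU)) (fun y hy => hH0 y (hbU hy)) (fun y hy => hH1 y (hbU hy))
      (hcarrier A fun q hq => (hHc q hq).1) (hcarrier B fun q hq => (hHc q hq).2)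
    obtain ⟨K, hK, hKH, hKG⟩ := ContinuousOn.exists_glue (hUclosed.prod isClosed_Icc)
      ((isClosed_gridCell p).prod (isClosed_Icc (a := (0 : ℝ)) (b := 1))) hH hG (by
        rintro ⟨y, t⟩ ⟨⟨hy, ht⟩, ⟨hyp, -⟩⟩
        exact (hGH ⟨hUp ⟨hy, hyp⟩, ht⟩).symm)
    have hcell : ∀ q ∈ D.erase p, gridCell q ×ˢ Icc (0 : ℝ) 1 ⊆ U ×ˢ Icc 0 1 := fun q hq =>
      prod_mono_left (subset_biUnion_of_mem (u := gridCell) hq)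
    refine ⟨K, by rwa [union_prod], ?_, ?_, fun q hq => ?_⟩
    · rintro y (hy | hy)
      · rw [hKH ⟨hy, by simp⟩, hH0 y hy]
      · rw [hKG ⟨hy, by simp⟩, hG0 y hy]
    · rintro y (hy | hy)
      · rw [hKH ⟨hy, by simp⟩]
        exact hH1 y hy
      · rw [hKG ⟨hy, by simp⟩]
        exact hG1 y hy
    · rcases eq_or_ne q p with rfl | hqp
      · exact ⟨fun h => (hGA h).congr hKG.symm, fun h => (hGB h).congr hKG.symm⟩
      · have hq' : q ∈ D.erase p := Finset.mem_erase.2 ⟨hqp, hq⟩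
        have := hKH.symm.mono (hcell q hq')
        exact ⟨fun h => ((hHc q hq').1 h).congr this, fun h => ((hHc q hq').2 h).congr this⟩

theorem exists_biUnion_gridCell_eq_sphere [Fintype ι] {N : ℕ} (hN : 0 < N) :
    ∃ D : Finset (ι → ℤ),
      (∀ p, p ∈ D ↔ (∀ k, -(2 * N : ℤ) ≤ p k ∧ p k ≤ 2 * N) ∧ ∃ k, |p k| = (2 * N : ℤ)) ∧
      ⋃ p ∈ D, gridCell p = sphere (0 : ι → ℝ) (2 * N) := by
  classical
  refine ⟨(Fintype.piFinset fun _ => Finset.Icc (-(2 * N : ℤ)) (2 * N)).filter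
    (fun p : ι → ℤ => ∃ k, |p k| = (2 * N : ℤ)), by simp, ?_⟩
  have hN' : (0 : ℝ) < 2 * N := by positivity
  ext y
  rw [mem_sphere_pi_iff hN']
  simp only [mem_closedBall, dist_zero_right, pi_norm_le_iff_of_nonneg hN'.le, mem_iUnion,
    Finset.mem_filter, Fintype.mem_piFinset, Finset.mem_Icc, Real.norm_eq_abs, exists_prop]
  have heven : ∀ z : ℤ, |z| = (2 * N : ℤ) → Even z := by
    intro z hz
    rcases (abs_eq (by positivity)).1 hz with h | h <;> simp [h]
  constructor
  · rintro ⟨p, ⟨hp, l, hl⟩, hy⟩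
    refine ⟨fun k => ?_, l, ?_⟩
    · rcases Int.even_or_odd (p k) with h | h
      · rw [(hy k).2 h]
        exact_mod_cast abs_le.2 (hp k)
      · have h1 : -(2 * N : ℤ) + 1 ≤ p k := by
          have := (hp k).1
          grind
        have h2 : p k ≤ 2 * N - 1 := by
          have := (hp k).2
          grind
        have h1' : -(2 * N : ℝ) + 1 ≤ p k := by exact_mod_cast h1
        have h2' : (p k : ℝ) ≤ 2 * N - 1 := by exact_mod_cast h2
        have h3 := abs_le.1 (hy k).1
        rw [abs_le]
        constructor <;> linarith
    · rw [(hy l).2 (heven _ hl)]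
      exact_mod_cast hl
  · rintro ⟨hy, l, hl⟩
    have key : ∀ r : ℝ, |r| ≤ 2 * N → ∃ z : ℤ, (-(2 * N : ℤ) ≤ z ∧ z ≤ 2 * N) ∧
        (|r - z| ≤ 1 ∧ (Even z → r = z)) ∧ (|r| = 2 * N → |z| = (2 * N : ℤ)) := by
      intro r hr
      by_cases hr' : |r| = 2 * N
      · obtain ⟨z, hz, rfl⟩ : ∃ z : ℤ, |z| = (2 * N : ℤ) ∧ r = z := by
          rcases (abs_eq hN'.le).1 hr' with h | h
          · exact ⟨2 * N, abs_of_nonneg (by positivity), by exact_mod_cast h⟩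
          · exact ⟨-(2 * N), by rw [abs_neg]; exact abs_of_nonneg (by positivity),
              by exact_mod_cast h⟩
        exact ⟨z, abs_le.1 hz.le, by simp, fun _ => hz⟩
      · have hlt := abs_lt.1 (lt_of_le_of_ne hr hr')
        have h1 := Int.floor_le (r / 2)
        have h2 := Int.lt_floor_add_one (r / 2)
        have h3 : ⌊r / 2⌋ < N := by
          have : (⌊r / 2⌋ : ℝ) < N := by linarith
          exact_mod_cast this
        have h4 : -(N : ℤ) ≤ ⌊r / 2⌋ := by
          rw [Int.le_floor]
          push_cast
          linarith
        refine ⟨2 * ⌊r / 2⌋ + 1, by constructor <;> linarith, ⟨?_, fun h => by grind⟩,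
          fun h => absurd h hr'⟩
        rw [abs_le]
        push_cast
        constructor <;> linarith
    choose p hp hyp hpl using fun k => key (y k) (hy k)
    exact ⟨p, ⟨hp, l, hpl l hl⟩, hyp⟩

/-- If `X` is covered by two relatively open subsets `A` and `B` such that all spheres in `A` can
be filled, and spheres of dimension less than `i` in `A ∩ B` and of dimension `i` in `B` can be
filled, then spheres of dimension `i` in `X` can be filled. -/
theorem FillsSphere.of_cover {X U W : Set E} (hU : IsOpen U) (hW : IsOpen W) (hX : X ⊆ U ∪ W)
    {i : ℕ} (hA : ∀ j, FillsSphere j (X ∩ U)) (hB : FillsSphere (i + 1) (X ∩ W))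
    (hAB : ∀ j ≤ i, FillsSphere j (X ∩ U ∩ (X ∩ W))) : FillsSphere (i + 1) X := by
  intro f hf hfX
  obtain ⟨u, hu, hfu⟩ := (continuousOn_iff'.1 hf) U hU
  obtain ⟨w, hw, hfw⟩ := (continuousOn_iff'.1 hf) W hW
  obtain ⟨δ, hδ, hball⟩ := lebesgue_number_lemma_of_metric (c := fun b : Bool => cond b u w)
    (isCompact_sphere (0 : Fin (i + 1) → ℝ) 1) (by rintro (_ | _) <;> assumption) (by
      intro x hx
      rw [mem_iUnion]
      rcases hX (hfX hx) with h | h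
      · exact ⟨true, (hfu.subset ⟨h, hx⟩).1⟩
      · exact ⟨false, (hfw.subset ⟨h, hx⟩).1⟩)
  obtain ⟨N, hNδ⟩ := exists_nat_gt δ⁻¹
  have hNpos : (0 : ℝ) < N := (inv_pos.2 hδ).trans hNδ
  have hN : 0 < N := by exact_mod_cast hNpos
  have hN2 : (0 : ℝ) < 2 * N := by positivity
  have hNδ' : (2 * N : ℝ)⁻¹ < δ := by
    rw [inv_lt_comm₀ hN2 hδ]
    linarith
  obtain ⟨D, hDmem, hDU⟩ := exists_biUnion_gridCell_eq_sphere (ι := Fin (i + 1)) hN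
  have hscale : MapsTo (fun y : Fin (i + 1) → ℝ => (2 * N : ℝ)⁻¹ • y)
      (sphere 0 (2 * N)) (sphere 0 1) := by
    intro y hy
    rw [mem_sphere_zero_iff_norm] at hy ⊢
    rw [norm_smul, hy, norm_inv, Real.norm_of_nonneg hN2.le, inv_mul_cancel₀ hN2.ne']
  have hDsub : ∀ p ∈ D, gridCell p ⊆ sphere (0 : Fin (i + 1) → ℝ) (2 * N) := fun p hp =>
    hDU ▸ subset_biUnion_of_mem (u := gridCell) hp
  have hcell : ∀ p ∈ D, MapsTo (fun y => f ((2 * N : ℝ)⁻¹ • y)) (gridCell p) (X ∩ U) ∨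
      MapsTo (fun y => f ((2 * N : ℝ)⁻¹ • y)) (gridCell p) (X ∩ W) := by
    intro p hp
    have hpp : (fun k => (p k : ℝ)) ∈ gridCell p := fun k => by simp
    obtain ⟨b, hb⟩ := hball _ (hscale (hDsub p hp hpp))
    have hmem : ∀ y ∈ gridCell p, (2 * N : ℝ)⁻¹ • y ∈ cond b u w := by
      intro y hy
      have hnorm : ‖y - fun k => (p k : ℝ)‖ ≤ 1 :=
        (pi_norm_le_iff_of_nonneg zero_le_one).2 fun k => (hy k).1
      apply hb
      rw [mem_ball, dist_eq_norm, ← smul_sub, norm_smul, norm_inv, Real.norm_of_nonneg hN2.le]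
      calc (2 * N : ℝ)⁻¹ * ‖y - fun k => (p k : ℝ)‖ ≤ (2 * N : ℝ)⁻¹ * 1 :=
            mul_le_mul_of_nonneg_left hnorm (inv_nonneg.2 hN2.le)
        _ = (2 * N : ℝ)⁻¹ := mul_one _
        _ < δ := hNδ'
    cases b with
    | true =>
      left
      intro y hy
      have := hscale (hDsub p hp hy)
      exact ⟨hfX this, (hfu.superset ⟨hmem y hy, this⟩).1⟩
    | false =>
      right
      intro y hy
      have := hscale (hDsub p hp hy)
      exact ⟨hfX this, (hfw.superset ⟨hmem y hy, this⟩).1⟩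
  obtain ⟨H, hH, hH0, hH1, hHc⟩ := exists_grid_compression hA
    (f := fun y => f ((2 * N : ℝ)⁻¹ • y)) (B := X ∩ W) D
    (by
      intro p hp q hq
      rw [hDmem] at hp ⊢
      obtain ⟨hp, k, hk⟩ := hp
      refine ⟨fun l => ?_, k, ?_⟩
      · rcases hq l with h | ⟨h1, h2⟩
        · rw [h]
          exact hp l
        · have := hp l
          rcases (abs_eq zero_le_one).1 h2 with h | h <;> constructor <;> grind
      · rcases hq k with h | ⟨h1, h2⟩
        · rwa [h]
        · rcases (abs_eq (by positivity)).1 hk with h | h <;> grind)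
    (by
      rw [hDU]
      exact hf.comp (by fun_prop) hscale)
    hcell
    (by
      intro p hp
      refine hAB _ ?_
      obtain ⟨-, k, hk⟩ := (hDmem p).1 hp
      have hlt : {k | Odd (p k)}.ncard < (univ : Set (Fin (i + 1))).ncard := by
        refine Set.ncard_lt_ncard ((ssubset_univ_iff).2 fun h => ?_)
        have h1 : Odd (p k) := h.superset (mem_univ k)
        rcases (abs_eq (by positivity)).1 hk with h | h <;> grind
      rw [Set.ncard_univ, Nat.card_fin] at hlt
      omega)
  rw [hDU] at hH hH0 hH1
  have hup : MapsTo (fun y : Fin (i + 1) → ℝ => (2 * N : ℝ) • y)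
      (sphere 0 1) (sphere 0 (2 * N)) := by
    intro y hy
    rw [mem_sphere_zero_iff_norm] at hy ⊢
    rw [norm_smul, hy, Real.norm_of_nonneg hN2.le, mul_one]
  have hHX : MapsTo H (sphere 0 (2 * N) ×ˢ Icc 0 1) X := by
    rintro ⟨y, t⟩ ⟨hy, ht⟩
    have hy' : y ∈ ⋃ p ∈ D, gridCell p := hDU ▸ hy
    simp only [mem_iUnion] at hy'
    obtain ⟨p, hp, hyp⟩ := hy'
    rcases hcell p hp with h | h
    · exact ((hHc p hp).1 h ⟨hyp, ht⟩).1
    · exact ((hHc p hp).2 h ⟨hyp, ht⟩).1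
  have hup' : MapsTo (fun q : (Fin (i + 1) → ℝ) × ℝ => ((2 * N : ℝ) • q.1, q.2))
      (sphere 0 1 ×ˢ Icc 0 1) (sphere 0 (2 * N) ×ˢ Icc 0 1) := fun q hq => ⟨hup hq.1, hq.2⟩
  have htop : MapsTo (fun y : Fin (i + 1) → ℝ => ((2 * N : ℝ) • y, (1 : ℝ)))
      (sphere 0 1) (sphere 0 (2 * N) ×ˢ Icc 0 1) := fun y hy => ⟨hup hy, by simp⟩
  obtain ⟨g, hg, hgB, hgH⟩ := hB (fun y => H ((2 * N : ℝ) • y, 1))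
    (hH.comp (by fun_prop) htop) fun y hy => hH1 _ (hup hy)
  refine (IsCell.cube (i + 1)).exists_extension_of_homotopy (hH.comp (by fun_prop) hup')
    (hHX.comp hup') (fun y hy => ?_) (fun y hy => (hgH hy).symm) hg fun y hy => (hgB hy).1
  simp only [Function.comp_apply]
  rw [hH0 _ (hup hy), smul_smul, inv_mul_cancel₀ hN2.ne', one_smul]

section HomotopyGroups

open unitInterval

variable {E : Type*} [TopologicalSpace E]

/-- The standard identification of `[-1, 1]ʲ` with `[0, 1]ʲ`. -/
noncomputable def toUnitCube {j : ℕ} (z : Fin j → ℝ) : Fin j → I :=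
  fun k => projIcc 0 1 zero_le_one ((z k + 1) / 2)

/-- The standard identification of `[0, 1]ʲ` with `[-1, 1]ʲ`. -/
def ofUnitCube {j : ℕ} (y : Fin j → I) : Fin j → ℝ :=
  fun k => 2 * y k - 1

theorem continuous_toUnitCube {j : ℕ} : Continuous (toUnitCube (j := j)) := by
  unfold toUnitCube
  fun_prop

theorem continuous_ofUnitCube {j : ℕ} : Continuous (ofUnitCube (j := j)) := by
  unfold ofUnitCube
  fun_prop

theorem toUnitCube_ofUnitCube {j : ℕ} (y : Fin j → I) : toUnitCube (ofUnitCube y) = y := by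
  ext k
  simp [toUnitCube, ofUnitCube]

theorem ofUnitCube_toUnitCube {j : ℕ} {z : Fin j → ℝ} (hz : z ∈ closedBall (0 : Fin j → ℝ) 1) :
    ofUnitCube (toUnitCube z) = z := by
  rw [mem_closedBall, dist_zero_right, pi_norm_le_iff_of_nonneg zero_le_one] at hz
  ext k
  have := abs_le.1 (hz k)
  simp only [ofUnitCube, toUnitCube]
  rw [projIcc_of_mem _ (⟨by linarith, by linarith⟩ : (z k + 1) / 2 ∈ Icc (0 : ℝ) 1)]
  dsimp only
  ring

theorem ofUnitCube_mem {j : ℕ} (y : Fin j → I) :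
    ofUnitCube y ∈ closedBall (0 : Fin j → ℝ) 1 := by
  rw [mem_closedBall, dist_zero_right, pi_norm_le_iff_of_nonneg zero_le_one]
  intro k
  have h0 := (y k).2.1
  have h1 := (y k).2.2
  rw [Real.norm_eq_abs, abs_le, ofUnitCube]
  constructor <;> linarith

theorem toUnitCube_mem_boundary {j : ℕ} {z : Fin j → ℝ} (hz : z ∈ sphere (0 : Fin j → ℝ) 1) :
    toUnitCube z ∈ Cube.boundary (Fin j) := by
  obtain ⟨-, l, hl⟩ := (mem_sphere_pi_iff one_pos).1 hz
  refine ⟨l, ?_⟩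
  rcases (abs_eq one_pos.le).1 hl with h | h
  · right
    simp [toUnitCube, h]
  · left
    simp [toUnitCube, h]

theorem ofUnitCube_mem_sphere {j : ℕ} {y : Fin j → I} (hy : y ∈ Cube.boundary (Fin j)) :
    ofUnitCube y ∈ sphere (0 : Fin j → ℝ) 1 := by
  obtain ⟨l, hl⟩ := hy
  refine (mem_sphere_pi_iff one_pos).2 ⟨ofUnitCube_mem y, l, ?_⟩
  rcases hl with h | h <;> norm_num [ofUnitCube, h]

/-- Every map from the `j`-cube to `X` that is constant on the boundary is homotopic, relative to
the boundary, to a constant map. -/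
def ContractsLoops (j : ℕ) (X : Set E) : Prop :=
  ∀ x ∈ X, ∀ f : (Fin j → ℝ) → E, ContinuousOn f (closedBall 0 1) → MapsTo f (closedBall 0 1) X →
    (∀ y ∈ sphere 0 1, f y = x) → ∃ H : (Fin j → ℝ) × ℝ → E,
      ContinuousOn H (closedBall 0 1 ×ˢ Icc 0 1) ∧ MapsTo H (closedBall 0 1 ×ˢ Icc 0 1) X ∧
      (∀ y ∈ closedBall 0 1, H (y, 0) = f y) ∧ (∀ y ∈ closedBall 0 1, H (y, 1) = x) ∧
      ∀ y ∈ sphere 0 1, ∀ t ∈ Icc (0 : ℝ) 1, H (y, t) = x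

theorem ContractsLoops.of_subsingleton {j : ℕ} {X : Set E}
    (h : ∀ x : X, Subsingleton (HomotopyGroup (Fin j) X x)) : ContractsLoops j X := by
  intro x hx f hf hfX hfx
  let g : GenLoop (Fin j) X ⟨x, hx⟩ :=
    ⟨⟨fun y => ⟨f (ofUnitCube y), hfX (ofUnitCube_mem y)⟩,
      (hf.comp_continuous continuous_ofUnitCube ofUnitCube_mem).subtype_mk _⟩,
      fun y hy => Subtype.ext (hfx _ (ofUnitCube_mem_sphere hy))⟩
  have hg : GenLoop.Homotopic g GenLoop.const :=
    Quotient.exact ((h ⟨x, hx⟩).elim (⟦g⟧ : HomotopyGroup (Fin j) X _) ⟦GenLoop.const⟧)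
  obtain ⟨G⟩ := hg
  refine ⟨fun p => G (projIcc 0 1 zero_le_one p.2, toUnitCube p.1), ?_, fun p _ => Subtype.coe_prop _,
    fun y hy => ?_, fun y hy => ?_, fun y hy t ht => ?_⟩
  · have := continuous_toUnitCube (j := j)
    have h2 : Continuous fun p : (Fin j → ℝ) × ℝ =>
        (projIcc (0 : ℝ) 1 zero_le_one p.2, toUnitCube p.1) := by fun_prop
    exact (continuous_subtype_val.comp (G.continuous.comp h2)).continuousOn
  · simp only [projIcc_left]
    change ((G (0, toUnitCube y) : X) : E) = f y
    rw [G.apply_zero]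
    exact congrArg f (ofUnitCube_toUnitCube hy)
  · simp only [projIcc_right]
    change ((G (1, toUnitCube y) : X) : E) = x
    rw [G.apply_one]
    rfl
  · simp only
    rw [G.eq_fst _ (toUnitCube_mem_boundary hy)]
    exact congrArg Subtype.val (GenLoop.boundary g _ (toUnitCube_mem_boundary hy))

theorem FillsSphere.subsingleton {j : ℕ} {X : Set E} (h : FillsSphere (j + 1) X) (x : X) :
    Subsingleton (HomotopyGroup (Fin j) X x) := by
  refine ⟨fun a b => ?_⟩
  induction a, b using Quotient.inductionOn₂ with | _ f g
  refine Quotient.sound ?_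
  have hcl : IsClosed (closedBall (0 : Fin j → ℝ) 1 ×ˢ {0, 1} ∪ sphere 0 1 ×ˢ Icc (0 : ℝ) 1) :=
    (IsCell.cube j).cylinder.isClosed_boundary
  set B := closedBall (0 : Fin j → ℝ) 1 ×ˢ {0, 1} ∪ sphere 0 1 ×ˢ Icc (0 : ℝ) 1
  have hloop : ∀ g : GenLoop (Fin j) X x, Continuous fun p : (Fin j → ℝ) × ℝ =>
      (g (toUnitCube p.1) : E) := fun g =>
    continuous_subtype_val.comp (g.1.continuous.comp (continuous_toUnitCube.comp continuous_fst))
  have hbd : ∀ (g : GenLoop (Fin j) X x), ∀ z ∈ sphere (0 : Fin j → ℝ) 1,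
      (g (toUnitCube z) : E) = x := fun g z hz =>
    congrArg Subtype.val (GenLoop.boundary g _ (toUnitCube_mem_boundary hz))
  obtain ⟨k, hk, hkf, hkg⟩ := ContinuousOn.exists_glue
    (hcl.inter (isClosed_le continuous_snd (continuous_const (y := (1 / 2 : ℝ)))))
    (hcl.inter (isClosed_le (continuous_const (y := (1 / 2 : ℝ))) continuous_snd))
    (hloop f).continuousOn (hloop g).continuousOn (by
      rintro ⟨z, t⟩ ⟨⟨hz, ht⟩, -, ht'⟩
      obtain rfl : t = 1 / 2 := le_antisymm ht ht'
      rcases hz with hz | hz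
      · have := hz.2
        norm_num at this
      · simp only [hbd f z hz.1, hbd g z hz.1])
  rw [← inter_union_distrib_left, inter_eq_left.2 (fun p _ => le_total p.2 (1 / 2))] at hk
  have hkB : ∀ p ∈ B, k p = f (toUnitCube p.1) ∨ k p = g (toUnitCube p.1) := fun p hp =>
    (le_total p.2 (1 / 2)).imp (fun h => hkf ⟨hp, h⟩) (fun h => hkg ⟨hp, h⟩)
  obtain ⟨G, hG, hGX, hGk⟩ := (IsCell.cube j).cylinder.extendsFrom_iff.2 h k hk (by
    intro p hp
    rcases hkB p hp with h | h <;> rw [h] <;> exact Subtype.coe_prop _)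
  have hmem : ∀ q : I × (Fin j → I), (ofUnitCube q.2, (q.1 : ℝ)) ∈
      closedBall (0 : Fin j → ℝ) 1 ×ˢ Icc (0 : ℝ) 1 := fun q => ⟨ofUnitCube_mem _, q.1.2⟩
  have hcont : Continuous fun q : I × (Fin j → I) => (ofUnitCube q.2, (q.1 : ℝ)) := by
    have := continuous_ofUnitCube (j := j)
    fun_prop
  refine ⟨⟨⟨⟨fun q => ⟨G (ofUnitCube q.2, q.1), hGX (hmem q)⟩,
    (hG.comp_continuous hcont hmem).subtype_mk _⟩, fun y => ?_, fun y => ?_⟩, fun t y hy => ?_⟩⟩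
  · have hB : (ofUnitCube y, (0 : ℝ)) ∈ B := Or.inl ⟨ofUnitCube_mem y, by simp⟩
    refine Subtype.ext ?_
    simp only [Icc.coe_zero]
    rw [hGk hB, hkf ⟨hB, by simp⟩]
    simp only [toUnitCube_ofUnitCube]
    rfl
  · have hB : (ofUnitCube y, (1 : ℝ)) ∈ B := Or.inl ⟨ofUnitCube_mem y, by simp⟩
    refine Subtype.ext ?_
    simp only [Icc.coe_one]
    rw [hGk hB, hkg ⟨hB, by norm_num⟩]
    simp only [toUnitCube_ofUnitCube]
    rfl
  · have hy' := ofUnitCube_mem_sphere hy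
    have hB : (ofUnitCube y, (t : ℝ)) ∈ B := Or.inr ⟨hy', t.2⟩
    refine Subtype.ext ?_
    have hfx : ((f.1 y : X) : E) = x := congrArg Subtype.val (GenLoop.boundary f y hy)
    simp only [ContinuousMap.coe_mk]
    rw [hGk hB, hfx]
    rcases hkB _ hB with h | h <;> rw [h]
    · exact hbd f _ hy'
    · exact hbd g _ hy'

theorem ContractsLoops.fillsSphere {j : ℕ} {X : Set E} (h : ContractsLoops j X) :
    FillsSphere (j + 1) X := by
  have hc := IsCell.cube j
  refine hc.cylinder.extendsFrom_iff.1 fun F hF hFX => ?_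
  set c := closedBall (0 : Fin j → ℝ) 1 with hcdef
  set d := sphere (0 : Fin j → ℝ) 1
  have hdc : d ⊆ c := hc.boundary_subset
  have hJ : c ×ˢ {0} ∪ d ×ˢ Icc (0 : ℝ) 1 ⊆ c ×ˢ {0, 1} ∪ d ×ˢ Icc (0 : ℝ) 1 :=
    union_subset_union_left _ (prod_mono_right (by simp))
  have hJc : c ×ˢ {0} ∪ d ×ˢ Icc (0 : ℝ) 1 ⊆ c ×ˢ Icc (0 : ℝ) 1 :=
    hJ.trans hc.cylinder.boundary_subset
  obtain ⟨F₁, hF₁, hF₁X, hF₁F⟩ :=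
    hc.extendsFrom_cylinder X F (hF.mono hJ) (hFX.mono_left hJ)
  have hz₀ : ((0 : Fin j → ℝ), (0 : ℝ)) ∈ c ×ˢ Icc (0 : ℝ) 1 := by simp [hcdef]
  have hconv : MapsTo (fun q : ((Fin j → ℝ) × ℝ) × ℝ => (1 - q.2) • q.1)
      ((c ×ˢ Icc (0 : ℝ) 1) ×ˢ Icc (0 : ℝ) 1) (c ×ˢ Icc (0 : ℝ) 1) := by
    rintro ⟨p, s⟩ ⟨hp, hs0, hs1⟩
    have := ((convex_closedBall (0 : Fin j → ℝ) 1).prod (convex_Icc (0 : ℝ) 1)) hp hz₀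
      (sub_nonneg.2 hs1) hs0 (by ring)
    simpa [Prod.mk_zero_zero, hcdef] using this
  have hK₁ : ContinuousOn (fun q : ((Fin j → ℝ) × ℝ) × ℝ => F₁ ((1 - q.2) • q.1))
      ((c ×ˢ Icc (0 : ℝ) 1) ×ˢ Icc (0 : ℝ) 1) := hF₁.comp (by fun_prop) hconv
  have hface : MapsTo (fun y : Fin j → ℝ => (y, (1 : ℝ))) c
      (c ×ˢ {0, 1} ∪ d ×ˢ Icc (0 : ℝ) 1) := fun y hy => Or.inl ⟨hy, by simp⟩
  have hside : MapsTo (fun p : (Fin j → ℝ) × ℝ => ((p.1, (1 : ℝ)), p.2)) (d ×ˢ Icc (0 : ℝ) 1)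
      ((c ×ˢ Icc (0 : ℝ) 1) ×ˢ Icc (0 : ℝ) 1) := fun p hp => ⟨⟨hdc hp.1, by simp⟩, hp.2⟩
  obtain ⟨g, hg, hgF, hgK⟩ := ContinuousOn.exists_glue
    (hc.isClosed.prod (isClosed_singleton (x := (0 : ℝ)))) (hc.isClosed_boundary.prod isClosed_Icc)
    (f := fun p : (Fin j → ℝ) × ℝ => F (p.1, 1))
    (g := fun p : (Fin j → ℝ) × ℝ => F₁ ((1 - p.2) • (p.1, (1 : ℝ))))
    (hF.comp (by fun_prop) fun p hp => hface hp.1)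
    (hK₁.comp (by fun_prop) hside)
    (by
      rintro ⟨y, t⟩ ⟨⟨-, ht⟩, ⟨hy, -⟩⟩
      obtain rfl : t = 0 := ht
      have := hF₁F (Or.inr ⟨hy, by simp⟩ : (y, (1 : ℝ)) ∈ _)
      simpa using this.symm)
  obtain ⟨G, hG, hGX, hGg⟩ := hc.extendsFrom_cylinder X g hg (by
    rintro p (hp | hp)
    · rw [hgF hp]
      exact hFX (hface hp.1)
    · have := hF₁X (hconv (hside hp))
      rwa [hgK hp])
  have htop : MapsTo (fun y : Fin j → ℝ => (y, (1 : ℝ))) c (c ×ˢ Icc (0 : ℝ) 1) :=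
    fun y hy => ⟨hy, by simp⟩
  have hGd : ∀ y ∈ d, ∀ s ∈ Icc (0 : ℝ) 1, G (y, s) = F₁ ((1 - s) • (y, (1 : ℝ))) :=
    fun y hy s hs => by rw [hGg (Or.inr ⟨hy, hs⟩), hgK ⟨hy, hs⟩]
  obtain ⟨L, hL, hLX, hL0, hL1, hLd⟩ := h (F₁ 0) (hF₁X hz₀) (fun y => G (y, 1))
    (hG.comp (by fun_prop) htop) (hGX.comp htop) (fun y hy => by simp [hGd y hy])
  have hflip : MapsTo (fun p : (Fin j → ℝ) × ℝ => (p.1, 1 - p.2)) (c ×ˢ Icc (0 : ℝ) 1)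
      (c ×ˢ Icc (0 : ℝ) 1) := by
    rintro ⟨y, t⟩ ⟨hy, ht0, ht1⟩
    dsimp at ht0 ht1
    exact ⟨hy, by constructor <;> dsimp <;> linarith⟩
  have hcyl : ∀ q ∈ (c ×ˢ {(1 : ℝ)}) ×ˢ Icc (0 : ℝ) 1, (q.1.1, q.2) ∈ c ×ˢ Icc (0 : ℝ) 1 :=
    fun q hq => ⟨hq.1.1, hq.2⟩
  have hJcl : IsClosed (c ×ˢ {0} ∪ d ×ˢ Icc (0 : ℝ) 1) :=
    (hc.isClosed.prod isClosed_singleton).union (hc.isClosed_boundary.prod isClosed_Icc)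
  obtain ⟨K, hK, hKF, hKG⟩ := ContinuousOn.exists_glue
    (hJcl.prod (isClosed_Icc (a := (0 : ℝ)) (b := 1)))
    ((hc.isClosed.prod (isClosed_singleton (x := (1 : ℝ)))).prod
      (isClosed_Icc (a := (0 : ℝ)) (b := 1)))
    (hK₁.mono (prod_mono_left hJc))
    (hG.comp (f := fun q : ((Fin j → ℝ) × ℝ) × ℝ => (q.1.1, q.2)) (by fun_prop) hcyl)
    (by
      rintro ⟨⟨y, t⟩, s⟩ ⟨⟨hy, hs⟩, ⟨-, ht⟩, -⟩
      obtain rfl : t = 1 := ht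
      have hyd : y ∈ d := by
        rcases hy with hy | hy
        · exact absurd hy.2 (by simp)
        · exact hy.1
      simp only [Function.comp_apply]
      rw [hGd y hyd s hs])
  have hBsplit : c ×ˢ {0, 1} ∪ d ×ˢ Icc (0 : ℝ) 1 =
      (c ×ˢ {0} ∪ d ×ˢ Icc (0 : ℝ) 1) ∪ c ×ˢ {(1 : ℝ)} := by
    rw [insert_eq, prod_union, union_right_comm]
  rw [← union_prod, ← hBsplit] at hK
  refine hc.cylinder.exists_extension_of_homotopy (H := K) (g := fun p => L (p.1, 1 - p.2)) hK
    ?_ ?_ ?_ (hL.comp (by fun_prop) hflip) (hLX.comp hflip)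
  · rintro ⟨p, s⟩ ⟨hp, hs⟩
    replace hp := hBsplit.subset hp
    rcases hp with hp | hp
    · have := hF₁X (hconv (⟨hJc hp, hs⟩ : (p, s) ∈ (c ×ˢ Icc (0 : ℝ) 1) ×ˢ Icc (0 : ℝ) 1))
      rwa [hKF ⟨hp, hs⟩]
    · rw [hKG ⟨hp, hs⟩]
      exact hGX (hcyl (p, s) ⟨hp, hs⟩)
  · intro p hp
    replace hp := hBsplit.subset hp
    rcases hp with hp | hp
    · rw [hKF ⟨hp, by simp⟩]
      simpa using hF₁F hp
    · rw [hKG ⟨hp, by simp⟩]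
      obtain ⟨y, t⟩ := p
      obtain ⟨hy, rfl⟩ : y ∈ c ∧ t = 1 := hp
      simp only [Function.comp_apply]
      have hy0 : (y, (0 : ℝ)) ∈ c ×ˢ {(0 : ℝ)} := ⟨hy, rfl⟩
      rw [hGg (Or.inl hy0), hgF hy0]
  · intro p hp
    replace hp := hBsplit.subset hp
    obtain ⟨y, t⟩ := p
    rcases hp with hp | hp
    · rw [hKF ⟨hp, by simp⟩]
      simp only [sub_self, zero_smul]
      rcases hp with ⟨hy, ht⟩ | ⟨hy, ht0, ht1⟩
      · obtain rfl : t = 0 := ht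
        simp [hL1 y hy]
      · dsimp at ht0 ht1
        rw [hLd y hy _ ⟨by linarith, by linarith⟩]
    · rw [hKG ⟨hp, by simp⟩]
      obtain ⟨hy, rfl⟩ : y ∈ c ∧ t = 1 := hp
      simp [hL0 y hy]

theorem isConn_iff_fillsSphere {E : Type} [TopologicalSpace E] [Nonempty E] {X : Set E} {n : ℤ} :
    IsConn X n ↔ ∀ j : ℕ, (j : ℤ) ≤ n + 1 → FillsSphere j X := by
  constructor
  · rintro ⟨h1, h2⟩ (_ | j) hj
    · exact fillsSphere_zero_iff.2 (nonempty_coe_sort.1 (h1 (by push_cast at hj; omega)))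
    · exact (ContractsLoops.of_subsingleton (h2 j (by push_cast at hj; omega))).fillsSphere
  · intro h
    exact ⟨fun hn => nonempty_coe_sort.2 (fillsSphere_zero_iff.1 (h 0 (by push_cast; omega))),
      fun i hi x => (h (i + 1) (by push_cast; omega)).subsingleton x⟩

end HomotopyGroups

section Segments

variable {E F : Type*} [TopologicalSpace E] [TopologicalSpace F] [AddCommGroup E] [Module ℝ E]
  [ContinuousAdd E] [ContinuousSMul ℝ E]

theorem fillsSphere_singleton (j : ℕ) (x : F) : FillsSphere j {x} :=
  fun _ _ hfX => ⟨fun _ => x, continuousOn_const, fun _ _ => rfl, fun _ hy => (hfX hy).symm⟩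

theorem FillsSphere.of_segments {j : ℕ} {X : Set E} {Y : Set F} (hY : FillsSphere j Y)
    {i : E → F} {r : F → E} (hi : ContinuousOn i X) (hr : ContinuousOn r Y)
    (hiY : MapsTo i X Y) (hrX : MapsTo r Y X)
    (h : ∀ x ∈ X, ∀ t ∈ Icc (0 : ℝ) 1, (1 - t) • x + t • r (i x) ∈ X) : FillsSphere j X := by
  have hri : ContinuousOn (fun p : E × ℝ => r (i p.1)) (X ×ˢ Icc 0 1) :=
    (hr.comp hi hiY).comp continuousOn_fst fun p hp => hp.1
  exact hY.of_dominated hi hr hiY hrX (H := fun p => (1 - p.2) • p.1 + p.2 • r (i p.1))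
    (((continuous_const.sub continuous_snd).continuousOn.smul continuousOn_fst).add
      (continuousOn_snd.smul hri))
    (fun p hp => h p.1 hp.1 p.2 hp.2) (by simp) (by simp)

end Segments

namespace ASC

section Space

variable {V : Type}

theorem eq_of_faces_eq {K L : ASC V} (h : K.faces = L.faces) : K = L := by
  cases K
  cases L
  cases h
  rfl

theorem mem_space_of_sum {K : ASC V} {x : V → ℝ} {s : Finset V} (hs : s ∈ K.faces)
    (h0 : ∀ v, 0 ≤ x v) (hxs : ∀ v, v ∉ s → x v = 0) (hx : ∑ v ∈ s, x v = 1) : x ∈ K.space :=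
  ⟨h0, s, hs, hxs, hx⟩

theorem exists_carrier {K : ASC V} {x : V → ℝ} (hx : x ∈ K.space) :
    ∃ s ∈ K.faces, (∀ v, v ∈ s ↔ 0 < x v) ∧ ∑ v ∈ s, x v = 1 := by
  classical
  obtain ⟨h0, s, hs, hxs, h1⟩ := hx
  have hsum : ∑ v ∈ s with 0 < x v, x v = 1 := by
    rw [← h1]
    refine Finset.sum_subset (Finset.filter_subset _ _) fun v hv hv' => ?_
    refine le_antisymm (not_lt.1 fun h => hv' ?_) (h0 v)
    exact Finset.mem_filter.2 ⟨hv, h⟩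
  refine ⟨s.filter (0 < x ·), K.down_closed hs (Finset.filter_subset _ _) ?_, fun v => ?_, hsum⟩
  · rw [Finset.nonempty_iff_ne_empty]
    intro h
    rw [h] at hsum
    simp at hsum
  · rw [Finset.mem_filter, and_iff_right_iff_imp]
    intro hv
    by_contra h
    exact hv.ne' (hxs v h)

theorem sum_eq_one {K : ASC V} {x : V → ℝ} (hx : x ∈ K.space) {s : Finset V}
    (hs : ∀ v, v ∉ s → x v = 0) : ∑ v ∈ s, x v = 1 := by
  obtain ⟨t, -, ht, h1⟩ := exists_carrier hx
  rw [← h1]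
  symm
  refine Finset.sum_subset (fun v hv => ?_) fun v _ hv => ?_
  · by_contra h
    exact ((ht v).1 hv).ne' (hs v h)
  · exact le_antisymm (not_lt.1 fun h => hv ((ht v).2 h)) (hx.1 v)

theorem segment_mem_space {K : ASC V} {x y : V → ℝ} (hx : x ∈ K.space) (hy : y ∈ K.space)
    (hxy : ∀ v, x v = 0 → y v = 0) {t : ℝ} (ht : t ∈ Icc (0 : ℝ) 1) :
    (1 - t) • x + t • y ∈ K.space := by
  obtain ⟨h0, s, hs, hxs, h1⟩ := hx
  refine mem_space_of_sum hs (fun v => ?_) (fun v hv => ?_) ?_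
  · exact add_nonneg (mul_nonneg (sub_nonneg.2 ht.2) (h0 v)) (mul_nonneg ht.1 (hy.1 v))
  · simp [hxs v hv, hxy v (hxs v hv)]
  · simp only [Pi.add_apply, Pi.smul_apply, smul_eq_mul, Finset.sum_add_distrib, ← Finset.mul_sum]
    rw [h1, sum_eq_one hy fun v hv => hxy v (hxs v hv)]
    ring

/-- The full subcomplex on a set of vertices. -/
def restrict (K : ASC V) (T : Set V) : ASC V where
  faces := {s | s ∈ K.faces ∧ (s : Set V) ⊆ T}
  nonempty_of_mem := fun _ hs => K.nonempty_of_mem hs.1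
  down_closed := fun _ _ hs hts ht =>
    ⟨K.down_closed hs.1 hts ht, (Finset.coe_subset.2 hts).trans hs.2⟩

theorem restrict_space_subset (K : ASC V) (T : Set V) : (K.restrict T).space ⊆ K.space :=
  fun _ ⟨h0, s, hs, h⟩ => ⟨h0, s, hs.1, h⟩

theorem eq_zero_of_mem_restrict {K : ASC V} {T : Set V} {x : V → ℝ}
    (hx : x ∈ (K.restrict T).space) {v : V} (hv : v ∉ T) : x v = 0 := by
  obtain ⟨-, s, hs, hxs, -⟩ := hx
  exact hxs v fun h => hv (hs.2 h)

theorem single_mem_space [DecidableEq V] {K : ASC V} {w : V} (hw : {w} ∈ K.faces) :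
    (Pi.single w 1 : V → ℝ) ∈ K.space := by
  refine mem_space_of_sum hw (fun v => ?_) (fun v hv => ?_) (by simp)
  · rcases eq_or_ne v w with rfl | h
    · simp
    · simp [h]
  · rw [Finset.mem_singleton] at hv
    simp [hv]

/-- Truncating the barycentric coordinates to a finite set of vertices, when their sum there is
positive. -/
noncomputable def truncate [DecidableEq V] (T : Finset V) (x : V → ℝ) : V → ℝ :=
  fun v => (∑ u ∈ T, x u)⁻¹ * if v ∈ T then x v else 0

theorem truncate_mem_space [DecidableEq V] {K : ASC V} {x : V → ℝ} (hx : x ∈ K.space)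
    {T : Finset V} (hT : 0 < ∑ u ∈ T, x u) {T' : Set V} (hTT' : (T : Set V) ⊆ T') :
    truncate T x ∈ (K.restrict T').space := by
  obtain ⟨s, hs, hxs, h1⟩ := exists_carrier hx
  have hsum : ∑ u ∈ s ∩ T, x u = ∑ u ∈ T, x u := by
    refine Finset.sum_subset Finset.inter_subset_right fun v hv hv' => ?_
    refine le_antisymm (not_lt.1 fun h => hv' ?_) (hx.1 v)
    exact Finset.mem_inter.2 ⟨(hxs v).2 h, hv⟩
  refine mem_space_of_sum (s := s ∩ T) ⟨K.down_closed hs Finset.inter_subset_left ?_, ?_⟩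
    (fun v => ?_) (fun v hv => ?_) ?_
  · rw [Finset.nonempty_iff_ne_empty]
    intro h
    rw [← hsum, h] at hT
    simp at hT
  · exact (Finset.coe_subset.2 Finset.inter_subset_right).trans hTT'
  · have := hx.1 v
    unfold truncate
    split_ifs <;> positivity
  · unfold truncate
    split_ifs with h
    · rw [Finset.mem_inter, not_and'] at hv
      rw [le_antisymm (not_lt.1 fun hlt => hv h ((hxs v).2 hlt)) (hx.1 v), mul_zero]
    · rw [mul_zero]
  · simp only [truncate, ← Finset.mul_sum]
    rw [Finset.sum_congr rfl fun v hv => if_pos (Finset.mem_inter.1 hv).2, hsum,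
      inv_mul_cancel₀ hT.ne']

theorem continuousOn_truncate [DecidableEq V] {T : Finset V} {X : Set (V → ℝ)}
    (hX : ∀ x ∈ X, 0 < ∑ u ∈ T, x u) : ContinuousOn (truncate T) X := by
  have hX' : ∀ x ∈ X, ∑ u ∈ T, x u ≠ 0 := fun x hx => (hX x hx).ne'
  unfold truncate
  rw [continuousOn_pi]
  intro v
  split_ifs <;> fun_prop (disch := assumption)

theorem fillsSphere_of_restrict [DecidableEq V] {K : ASC V} {j : ℕ}
    (h : ∀ T : Finset V, ∃ T' : Set V, (T : Set V) ⊆ T' ∧ FillsSphere j (K.restrict T').space) :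
    FillsSphere j K.space := by
  intro f hf hfX
  obtain ⟨T, hT⟩ : ∃ T : Finset V, ∀ y ∈ sphere 0 1 ∩ sphere 0 1, 0 < ∑ u ∈ T, f y u := by
    refine (isCompact_sphere (0 : Fin j → ℝ) 1).induction_on
      (p := fun A => ∃ T : Finset V, ∀ y ∈ A ∩ sphere 0 1, 0 < ∑ u ∈ T, f y u)
      ⟨∅, by simp⟩ ?_ ?_ ?_
    · rintro A B hAB ⟨T, hT⟩
      exact ⟨T, fun y hy => hT y ⟨hAB hy.1, hy.2⟩⟩
    · rintro A B ⟨T, hT⟩ ⟨T', hT'⟩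
      refine ⟨T ∪ T', fun y hy => ?_⟩
      have hnn : ∀ v, 0 ≤ f y v := (hfX hy.2).1
      rcases hy.1 with h | h
      · exact (hT y ⟨h, hy.2⟩).trans_le (Finset.sum_le_sum_of_subset_of_nonneg
          Finset.subset_union_left fun v _ _ => hnn v)
      · exact (hT' y ⟨h, hy.2⟩).trans_le (Finset.sum_le_sum_of_subset_of_nonneg
          Finset.subset_union_right fun v _ _ => hnn v)
    · intro y hy
      obtain ⟨s, -, -, h1⟩ := exists_carrier (hfX hy)
      have hcont : ContinuousOn (fun y => ∑ u ∈ s, f y u) (sphere 0 1) :=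
        continuousOn_finsetSum s fun u _ => (continuous_apply u).comp_continuousOn hf
      have hev := (hcont y hy).eventually (lt_mem_nhds (h1 ▸ one_pos))
      exact ⟨_, hev, s, fun z hz => hz.1⟩
  rw [inter_self] at hT
  obtain ⟨T', hTT', hfill⟩ := h T
  have hcont : ContinuousOn (fun y => truncate T (f y)) (sphere 0 1) :=
    (continuousOn_truncate (X := {x | 0 < ∑ u ∈ T, x u}) fun _ hx => hx).comp hf hT
  obtain ⟨g, hg, hgX, hgf⟩ := hfill _ hcont fun y hy =>
    truncate_mem_space (hfX hy) (hT y hy) hTT'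
  have hfst : MapsTo (Prod.fst : (Fin j → ℝ) × ℝ → _) (sphere 0 1 ×ˢ Icc (0 : ℝ) 1)
      (sphere 0 1) := fun p hp => hp.1
  have hf' := hf.comp continuousOn_fst hfst
  have hcont' := hcont.comp continuousOn_fst hfst
  refine (IsCell.cube j).exists_extension_of_homotopy
    (H := fun p => (1 - p.2) • f p.1 + p.2 • truncate T (f p.1)) ?_ (fun p hp => ?_) (by simp)
    (fun y hy => by simp [hgf hy]) hg fun y hy => restrict_space_subset _ _ (hgX hy)
  · exact ((by fun_prop : ContinuousOn (fun p : (Fin j → ℝ) × ℝ => 1 - p.2) _).smul hf').add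
      (continuousOn_snd.smul hcont')
  · refine segment_mem_space (hfX hp.1) (restrict_space_subset _ T'
      (truncate_mem_space (hfX hp.1) (hT _ hp.1) hTT')) (fun v hv => ?_) hp.2
    simp [truncate, hv]

theorem restrict_restrict (K : ASC V) (T T' : Set V) :
    (K.restrict T).restrict T' = K.restrict (T ∩ T') :=
  eq_of_faces_eq (Set.ext fun _ => ⟨fun h => ⟨h.1.1, subset_inter h.1.2 h.2⟩,
    fun h => ⟨⟨h.1, h.2.trans inter_subset_left⟩, h.2.trans inter_subset_right⟩⟩)

theorem restrict_insert_of_notMem (K : ASC V) {w : V} (hw : {w} ∉ K.faces) (T : Set V) :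
    K.restrict (insert w T) = K.restrict T := by
  refine eq_of_faces_eq (Set.ext fun s => ⟨fun h => ⟨h.1, fun v hv => ?_⟩,
    fun h => ⟨h.1, h.2.trans (subset_insert _ _)⟩⟩)
  rcases h.2 hv with rfl | h'
  · exact absurd (K.down_closed h.1 (Finset.singleton_subset_iff.2 hv) (by simp)) hw
  · exact h'

end Space

section Vertex

variable {V : Type} [DecidableEq V]

/-- Radial projection away from a vertex. -/
noncomputable def projVertex (w : V) (x : V → ℝ) : V → ℝ :=
  (1 - x w)⁻¹ • Function.update x w 0

theorem continuousOn_projVertex (w : V) {X : Set (V → ℝ)} (hX : ∀ x ∈ X, x w < 1) :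
    ContinuousOn (projVertex w) X := by
  have hX' : ∀ x ∈ X, 1 - x w ≠ 0 := fun x hx => (sub_pos.2 (hX x hx)).ne'
  have hu : Continuous fun x : V → ℝ => Function.update x w 0 :=
    continuous_id.update w continuous_const
  unfold projVertex
  fun_prop (disch := assumption)

theorem projVertex_nonneg {K : ASC V} {w : V} {x : V → ℝ} (hx : x ∈ K.space) (hw : x w < 1)
    (v : V) : 0 ≤ projVertex w x v := by
  refine mul_nonneg (inv_nonneg.2 (sub_pos.2 hw).le) ?_
  rcases eq_or_ne v w with rfl | h
  · simp
  · simpa [h] using hx.1 v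

theorem projVertex_eq_zero {w v : V} {x : V → ℝ} (h : x v = 0) : projVertex w x v = 0 := by
  rcases eq_or_ne v w with rfl | h'
  · simp [projVertex]
  · simp [projVertex, h', h]

theorem exists_erase_carrier {K : ASC V} {w : V} {x : V → ℝ} (hx : x ∈ K.space) (hw : x w < 1) :
    ∃ s ∈ K.faces, (∀ v, v ∈ s ↔ 0 < x v) ∧ s.erase w ∈ K.faces ∧
      (∀ v ∉ s.erase w, projVertex w x v = 0) ∧ ∑ v ∈ s.erase w, projVertex w x v = 1 := by
  obtain ⟨s, hs, hxs, h1⟩ := exists_carrier hx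
  have hx0 : ∀ v ∉ s, x v = 0 := fun v hv =>
    le_antisymm (not_lt.1 fun h => hv ((hxs v).2 h)) (hx.1 v)
  have hsum : ∑ v ∈ s.erase w, projVertex w x v = 1 := by
    have hstep : ∑ v ∈ s.erase w, projVertex w x v = (1 - x w)⁻¹ * ∑ v ∈ s.erase w, x v := by
      rw [Finset.mul_sum]
      refine Finset.sum_congr rfl fun v hv => ?_
      simp [projVertex, Finset.ne_of_mem_erase hv]
    have herase : ∑ v ∈ s.erase w, x v = 1 - x w := by
      by_cases hws : w ∈ s
      · rw [← h1, ← Finset.add_sum_erase s x hws]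
        ring
      · rw [Finset.erase_eq_of_notMem hws, h1, hx0 w hws, sub_zero]
    rw [hstep, herase, inv_mul_cancel₀ (sub_pos.2 hw).ne']
  refine ⟨s, hs, hxs, K.down_closed hs (Finset.erase_subset _ _) ?_, fun v hv => ?_, hsum⟩
  · rw [Finset.nonempty_iff_ne_empty]
    intro h
    rw [h] at hsum
    simp at hsum
  · rw [Finset.mem_erase, not_and_or, not_not] at hv
    rcases hv with rfl | hv
    · simp [projVertex]
    · exact projVertex_eq_zero (hx0 v hv)

theorem projVertex_mem_restrict {K : ASC V} {w : V} {x : V → ℝ} (hx : x ∈ K.space)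
    (hw : x w < 1) : projVertex w x ∈ (K.restrict {w}ᶜ).space := by
  obtain ⟨s, -, -, hs, h0, h1⟩ := exists_erase_carrier hx hw
  exact mem_space_of_sum ⟨hs, fun v hv => Finset.ne_of_mem_erase hv⟩ (projVertex_nonneg hx hw) h0 h1

theorem projVertex_mem_link {K : ASC V} {w : V} {x : V → ℝ} (hx : x ∈ K.space)
    (hw0 : 0 < x w) (hw : x w < 1) : projVertex w x ∈ (K.link {w}).space := by
  obtain ⟨s, hs, hxs, hs', h0, h1⟩ := exists_erase_carrier hx hw
  refine mem_space_of_sum ⟨hs', by simp, ?_⟩ (projVertex_nonneg hx hw) h0 h1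
  rwa [← Finset.insert_eq, Finset.insert_erase ((hxs w).2 hw0)]

theorem half_single_add_mem {K : ASC V} {w : V} {z : V → ℝ} (hz : z ∈ (K.link {w}).space) :
    (1 / 2 : ℝ) • (Pi.single w 1 + z) ∈ K.space ∧ z w = 0 := by
  obtain ⟨h0, s, ⟨hs, hws, hs'⟩, hzs, h1⟩ := hz
  rw [Finset.disjoint_singleton_left] at hws
  have hw := hzs w hws
  refine ⟨mem_space_of_sum hs' (fun v => ?_) (fun v hv => ?_) ?_, hw⟩
  · have := h0 v
    rcases eq_or_ne v w with rfl | h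
    · simp [hw]
    · simpa [h] using this
  · rw [Finset.mem_union, Finset.mem_singleton, not_or] at hv
    simp [hv.1, hzs v hv.2]
  · rw [Finset.sum_union (Finset.disjoint_singleton_left.2 hws)]
    have : ∀ v ∈ s, ((1 / 2 : ℝ) • (Pi.single w 1 + z) : V → ℝ) v = 1 / 2 * z v := by
      intro v hv
      have : v ≠ w := fun h => hws (h ▸ hv)
      simp [this]
    rw [Finset.sum_congr rfl this, ← Finset.mul_sum, h1]
    norm_num [hw]

/-- Attaching a vertex along its link. -/
theorem fillsSphere_of_vertex {K : ASC V} {w : V} (hw : {w} ∈ K.faces) {n : ℕ}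
    (hdel : ∀ j ≤ n, FillsSphere j (K.restrict {w}ᶜ).space)
    (hlink : ∀ j < n, FillsSphere j (K.link {w}).space) {j : ℕ} (hj : j ≤ n) :
    FillsSphere j K.space := by
  obtain _ | i := j
  · exact fillsSphere_zero_iff.2 ⟨_, single_mem_space hw⟩
  have hU : IsOpen {x : V → ℝ | 0 < x w} := isOpen_lt (by fun_prop) (by fun_prop)
  have hW : IsOpen {x : V → ℝ | x w < 1} := isOpen_lt (by fun_prop) (by fun_prop)
  refine FillsSphere.of_cover hU hW (fun x _ => ?_) (fun j => ?_) ?_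
    (fun j hj' => ?_)
  · rcases lt_or_ge 0 (x w) with h | h
    · exact Or.inl h
    · exact Or.inr (h.trans_lt one_pos)
  · have hw' := single_mem_space hw
    refine (fillsSphere_singleton j (Pi.single w 1 : V → ℝ)).of_segments
      (i := fun _ => Pi.single w 1) (r := id) continuousOn_const continuousOn_id
      (fun _ _ => rfl) ?_ fun x hx t ht => ⟨?_, ?_⟩
    · rintro _ rfl
      exact ⟨hw', by simp⟩
    · refine segment_mem_space hx.1 hw' (fun v hv => ?_) ht
      have hxw : 0 < x w := hx.2
      have : v ≠ w := by
        rintro rfl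
        exact hxw.ne' hv
      simp [this]
    · have hxw : 0 < x w := hx.2
      obtain ⟨ht0, ht1⟩ := ht
      simp only [mem_ofPred_eq, id, Pi.add_apply, Pi.smul_apply, smul_eq_mul, Pi.single_eq_same]
      rcases ht0.eq_or_lt with rfl | h
      · simpa using hxw
      · nlinarith [mul_nonneg (sub_nonneg.2 ht1) hxw.le]
  · refine (hdel (i + 1) hj).of_segments (i := projVertex w) (r := id)
      (continuousOn_projVertex w fun x hx => hx.2) continuousOn_id
      (fun x hx => projVertex_mem_restrict hx.1 hx.2)
      (fun x hx => ⟨restrict_space_subset _ _ hx, ?_⟩) fun x hx t ht => ⟨?_, ?_⟩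
    · have : x w = 0 := eq_zero_of_mem_restrict hx (by simp)
      simp [this]
    · exact segment_mem_space hx.1 (restrict_space_subset _ _ (projVertex_mem_restrict hx.1 hx.2))
        (fun v hv => projVertex_eq_zero hv) ht
    · have hxw : x w < 1 := hx.2
      have hx0 := hx.1.1 w
      obtain ⟨ht0, ht1⟩ := ht
      simp only [mem_ofPred_eq, id, Pi.add_apply, Pi.smul_apply, smul_eq_mul, projVertex,
        Function.update_self]
      nlinarith [mul_nonneg ht0 hx0]
  · have hmaps : ∀ z ∈ (K.link {w}).space, (1 / 2 : ℝ) • (Pi.single w 1 + z) ∈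
        K.space ∩ {x | 0 < x w} ∩ (K.space ∩ {x | x w < 1}) := by
      intro z hz
      obtain ⟨h1, h2⟩ := half_single_add_mem hz
      exact ⟨⟨h1, by simp [h2]⟩, h1, by norm_num [h2]⟩
    have hproj : ∀ x ∈ K.space ∩ {x | 0 < x w} ∩ (K.space ∩ {x | x w < 1}),
        projVertex w x ∈ (K.link {w}).space := fun x hx =>
      projVertex_mem_link hx.1.1 hx.1.2 hx.2.2
    refine (hlink j (by omega)).of_segments (i := projVertex w)
      (r := fun z => (1 / 2 : ℝ) • (Pi.single w 1 + z))
      (continuousOn_projVertex w fun x hx => hx.2.2) (by fun_prop) hproj hmaps fun x hx t ht => ?_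
    have hxw0 : 0 < x w := hx.1.2
    have hxw1 : x w < 1 := hx.2.2
    have hmem : (1 - t) • x + t • ((1 / 2 : ℝ) • (Pi.single w 1 + projVertex w x)) ∈ K.space := by
      refine segment_mem_space hx.1.1 (hmaps _ (hproj x hx)).1.1 (fun v hv => ?_) ht
      have : v ≠ w := by
        rintro rfl
        exact hxw0.ne' hv
      simp [this, projVertex_eq_zero hv]
    have hval : ((1 - t) • x + t • ((1 / 2 : ℝ) • (Pi.single w 1 + projVertex w x)) : V → ℝ) w =
        (1 - t) * x w + t * (1 / 2) := by
      simp [projVertex]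
    obtain ⟨ht0, ht1⟩ := ht
    refine ⟨⟨hmem, ?_⟩, hmem, ?_⟩
    · rw [mem_ofPred_eq, hval]
      rcases ht0.eq_or_lt with rfl | h
      · simpa using hxw0
      · nlinarith [mul_nonneg (sub_nonneg.2 ht1) hxw0.le]
    · rw [mem_ofPred_eq, hval]
      rcases ht0.eq_or_lt with rfl | h
      · simpa using hxw1
      · nlinarith [mul_nonneg (sub_nonneg.2 ht1) (sub_nonneg.2 hxw1.le)]

end Vertex

end ASC

namespace ASC

section LabelWith

variable {V S : Type}

/-- The embedding of barycentric coordinates given by labeling every vertex with `s₀`. -/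
def labelWith [DecidableEq S] (s₀ : S) (x : V → ℝ) : V × S → ℝ :=
  fun p => if p.2 = s₀ then x p.1 else 0

theorem continuous_labelWith [DecidableEq S] (s₀ : S) :
    Continuous (labelWith (V := V) s₀) := by
  unfold labelWith
  refine continuous_pi fun p => ?_
  split_ifs <;> fun_prop

end LabelWith

variable {V S : Type} [DecidableEq V]

theorem link_link (K : ASC V) {v : V} {s : Finset V} (hs : s ∈ (K.link {v}).faces) :
    (K.link {v}).link s = K.link ({v} ∪ s) := by
  obtain ⟨-, hvs, -⟩ := hs
  refine eq_of_faces_eq (Set.ext fun t => ⟨?_, ?_⟩)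
  · rintro ⟨⟨h1, h2, h3⟩, h4, -, h5, h6⟩
    exact ⟨h1, Finset.disjoint_union_left.2 ⟨h2, h4⟩, by rwa [Finset.union_assoc]⟩
  · rintro ⟨h1, h2, h3⟩
    rw [Finset.disjoint_union_left] at h2
    rw [Finset.union_assoc] at h3
    have hne := K.nonempty_of_mem h1
    exact ⟨⟨h1, h2.1, K.down_closed h3
        (Finset.union_subset_union_right Finset.subset_union_right)
        (hne.mono Finset.subset_union_right)⟩, h2.2,
      K.down_closed h3 Finset.subset_union_right (hne.mono Finset.subset_union_right),
      Finset.disjoint_union_right.2 ⟨hvs, h2.1⟩, h3⟩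

theorem link_restrict_labeled [DecidableEq S] (K : ASC V) {w : V × S} {T : Set (V × S)}
    (hw : w ∈ T) :
    ((labeled K S).restrict T).link {w} = (labeled (K.link {w.1}) S).restrict T := by
  refine eq_of_faces_eq (Set.ext fun t => ⟨?_, ?_⟩)
  · rintro ⟨⟨⟨h1, h2⟩, h3⟩, h4, ⟨h5, h6⟩, -⟩
    rw [Finset.image_union, Finset.image_singleton] at h5
    refine ⟨⟨⟨h1, ?_, h5⟩, h2⟩, h3⟩
    rw [Finset.disjoint_singleton_left] at h4 ⊢
    intro h
    obtain ⟨p, hp, hpw⟩ := Finset.mem_image.1 h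
    exact h4 (h6 p (by simp [hp]) w (by simp) hpw ▸ hp)
  · rintro ⟨⟨⟨h1, h4, h5⟩, h2⟩, h3⟩
    rw [Finset.disjoint_singleton_left] at h4
    have hne : ∀ p ∈ t, p.1 ≠ w.1 := fun p hp h => h4 (h ▸ Finset.mem_image_of_mem _ hp)
    refine ⟨⟨⟨h1, h2⟩, h3⟩, ?_, ⟨?_, ?_⟩, ?_⟩
    · exact Finset.disjoint_singleton_left.2 fun h => hne w h rfl
    · rwa [Finset.image_union, Finset.image_singleton]
    · intro p hp q hq hpq
      rw [Finset.mem_union, Finset.mem_singleton] at hp hq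
      rcases hp with rfl | hp <;> rcases hq with rfl | hq
      · rfl
      · exact absurd hpq.symm (hne q hq)
      · exact absurd hpq (hne p hp)
      · exact h2 p hp q hq hpq
    · rw [Finset.coe_union, Finset.coe_singleton]
      exact union_subset (singleton_subset_iff.2 hw) h3

theorem labelWith_mem [DecidableEq S] {K : ASC V} (s₀ : S) {x : V → ℝ} (hx : x ∈ K.space) :
    labelWith s₀ x ∈ ((labeled K S).restrict {p | p.2 = s₀}).space := by
  obtain ⟨h0, s, hs, hxs, h1⟩ := hx
  have hinj : Function.Injective fun v : V => (v, s₀) := fun v w h => congrArg Prod.fst h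
  refine mem_space_of_sum (s := s.image fun v => (v, s₀)) ⟨⟨?_, ?_⟩, ?_⟩ (fun p => ?_)
    (fun p hp => ?_) ?_
  · rw [Finset.image_image]
    simpa [Function.comp_def] using hs
  · simp only [Finset.mem_image]
    rintro _ ⟨v, -, rfl⟩ _ ⟨w, -, rfl⟩ h
    exact congrArg (·, s₀) h
  · intro p hp
    obtain ⟨v, -, rfl⟩ := Finset.mem_image.1 hp
    rfl
  · unfold labelWith
    split_ifs
    exacts [h0 _, le_rfl]
  · unfold labelWith
    split_ifs with h
    · exact hxs _ fun hv => hp (Finset.mem_image.2 ⟨p.1, hv, by rw [← h]⟩)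
    · rfl
  · rw [Finset.sum_image hinj.injOn, ← h1]
    simp [labelWith]

theorem fillsSphere_restrict_labeled_base [DecidableEq S] {K : ASC V} {j : ℕ}
    (h : FillsSphere j K.space) (s₀ : S) :
    FillsSphere j ((labeled K S).restrict {p | p.2 = s₀}).space := by
  refine h.of_retract (i := fun y v => y (v, s₀)) (r := labelWith s₀) (by fun_prop)
    (continuous_labelWith s₀).continuousOn (fun y hy => ?_) (fun x hx => labelWith_mem s₀ hx)
    fun y hy => ?_
  · obtain ⟨h0, t, ⟨⟨ht, htinj⟩, hts⟩, hyt, h1⟩ := hy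
    refine mem_space_of_sum ht (fun v => h0 _) (fun v hv => ?_) ?_
    · exact hyt _ fun h => hv (Finset.mem_image.2 ⟨_, h, rfl⟩)
    · rw [Finset.sum_image fun p hp q hq => htinj p hp q hq, ← h1]
      refine Finset.sum_congr rfl fun p hp => ?_
      have : p.2 = s₀ := hts hp
      rw [← this]
  · ext p
    unfold labelWith
    split_ifs with h
    · rw [← h]
    · exact (eq_zero_of_mem_restrict hy h).symm

theorem fillsSphere_restrict_labeled [DecidableEq S] (s₀ : S) {n : ℕ} {K : ASC V}
    (hK : ∀ j ≤ n, FillsSphere j K.space)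
    (hlink : ∀ s ∈ K.faces, ∀ j, j + s.card ≤ n → FillsSphere j (K.link s).space)
    (T : Finset (V × S)) :
    ∀ j ≤ n, FillsSphere j ((labeled K S).restrict ({p | p.2 = s₀} ∪ T)).space := by
  induction n generalizing K T with
  | zero =>
    intro j hj
    obtain rfl : j = 0 := by omega
    obtain ⟨x, hx⟩ := fillsSphere_zero_iff.1 (fillsSphere_restrict_labeled_base (hK 0 le_rfl) s₀)
    obtain ⟨h0, s, hs, h⟩ := hx
    exact fillsSphere_zero_iff.2 ⟨x, h0, s, ⟨hs.1, hs.2.trans subset_union_left⟩, h⟩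
  | succ n ihn =>
    induction T using Finset.induction_on with
    | empty =>
      intro j hj
      rw [Finset.coe_empty, union_empty]
      exact fillsSphere_restrict_labeled_base (hK j hj) s₀
    | insert w T hwT ih =>
      rw [Finset.coe_insert, union_insert]
      by_cases hws : w ∈ ({p | p.2 = s₀} ∪ T : Set (V × S))
      · rwa [insert_eq_of_mem hws]
      by_cases hw : {w} ∈ (labeled K S).faces
      · intro j hj
        have hv : {w.1} ∈ K.faces := by simpa using hw.1
        refine fillsSphere_of_vertex (w := w) (n := n + 1) ?_ ?_ ?_ hj
        · exact ⟨hw, by simp⟩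
        · rw [restrict_restrict, insert_inter_of_notMem (by simp), inter_eq_left.2]
          · exact ih
          · rintro p hp rfl
            exact hws hp
        · intro j hj
          rw [link_restrict_labeled K (mem_insert _ _), ← union_insert, ← Finset.coe_insert]
          refine ihn (fun j hj => hlink _ hv j (by simpa using hj)) (fun s hs j hj => ?_) _ j
            (by omega)
          rw [link_link K hs]
          refine hlink _ hs.2.2 j ?_
          rw [Finset.card_union_of_disjoint hs.2.1, Finset.card_singleton]
          omega
      · rwa [restrict_insert_of_notMem _ hw]

theorem fillsSphere_labeled [Nonempty S] {n : ℕ} {K : ASC V}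
    (hK : ∀ j ≤ n, FillsSphere j K.space)
    (hlink : ∀ s ∈ K.faces, ∀ j, j + s.card ≤ n → FillsSphere j (K.link s).space)
    {j : ℕ} (hj : j ≤ n) : FillsSphere j (labeled K S).space := by
  classical
  exact fillsSphere_of_restrict fun T => ⟨_, subset_union_right,
    fillsSphere_restrict_labeled (Classical.arbitrary S) hK hlink T j hj⟩

theorem push_eq_sum {W : Type} [DecidableEq W] {φ : V → W} {y : V → ℝ} {t : Finset V}
    (hy : ∀ p, p ∉ t → y p = 0) (w : W) : push φ y w = ∑ p ∈ t with φ p = w, y p := by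
  unfold push
  rw [finsum_mem_eq_sum_of_inter_support_eq]
  ext p
  simp only [mem_inter_iff, mem_preimage, mem_singleton_iff, Function.mem_support,
    Finset.coe_filter, mem_ofPred_eq]
  refine ⟨fun h => ⟨⟨?_, h.1⟩, h.2⟩, fun h => ⟨h.1.2, h.2⟩⟩
  by_contra hp
  exact h.2 (hy p hp)

theorem push_fst_mem {K : ASC V} {y : V × S → ℝ} (hy : y ∈ (labeled K S).space) :
    push Prod.fst y ∈ K.space := by
  classical
  obtain ⟨h0, t, ⟨ht, -⟩, hyt, h1⟩ := hy
  refine mem_space_of_sum ht (fun v => ?_) (fun v hv => ?_) ?_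
  · rw [push_eq_sum hyt]
    exact Finset.sum_nonneg fun p _ => h0 p
  · rw [push_eq_sum hyt, Finset.filter_eq_empty_iff.2, Finset.sum_empty]
    rintro p hp rfl
    exact hv (Finset.mem_image_of_mem _ hp)
  · simp only [push_eq_sum hyt]
    rw [Finset.sum_fiberwise_of_maps_to fun p hp => Finset.mem_image_of_mem _ hp, h1]

theorem continuousOn_push {W : Type} (φ : V → W) (L : ASC V) :
    ContinuousOn (push φ) L.space := by
  classical
  rw [continuousOn_pi]
  intro w x hx
  obtain ⟨-, t, -, hxt, hx1⟩ := hx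
  have hlower : ContinuousWithinAt (fun y : V → ℝ => ∑ p ∈ t with φ p = w, y p) L.space x :=
    Continuous.continuousWithinAt (by fun_prop)
  have hupper : ContinuousWithinAt
      (fun y : V → ℝ => ∑ p ∈ t with φ p = w, y p + (1 - ∑ p ∈ t, y p)) L.space x :=
    Continuous.continuousWithinAt (by fun_prop)
  unfold ContinuousWithinAt at hlower hupper ⊢
  simp only [hx1, sub_self, add_zero] at hupper
  beta_reduce
  rw [push_eq_sum hxt]
  refine tendsto_of_tendsto_of_tendsto_of_le_of_le' hlower hupper
    (eventually_mem_nhdsWithin.mono fun y hy => ?_) (eventually_mem_nhdsWithin.mono fun y hy => ?_)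
  all_goals
    obtain ⟨s, -, hys, -⟩ := hy.2
    have hysub : ∀ p, p ∉ t ∪ s → y p = 0 := fun p hp =>
      hys p fun h => hp (Finset.mem_union_right _ h)
    rw [push_eq_sum hysub]
  · exact Finset.sum_le_sum_of_subset_of_nonneg
      (Finset.filter_subset_filter _ Finset.subset_union_left) fun p _ _ => hy.1 p
  · have h1 := sum_eq_one hy hysub
    have h2 := Finset.sum_sdiff (f := y) (Finset.subset_union_left (s₁ := t) (s₂ := s))
    have h3 := Finset.sum_sdiff (f := y)
      (Finset.filter_subset_filter (φ · = w) (Finset.subset_union_left (s₁ := t) (s₂ := s)))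
    have h4 : ∑ p ∈ ((t ∪ s).filter (φ · = w)) \ t.filter (φ · = w), y p ≤
        ∑ p ∈ (t ∪ s) \ t, y p := by
      refine Finset.sum_le_sum_of_subset_of_nonneg (fun p hp => ?_) fun p _ _ => hy.1 p
      simp only [Finset.mem_sdiff, Finset.mem_filter, not_and'] at hp ⊢
      exact ⟨hp.1.1, hp.2 hp.1.2⟩
    linarith

theorem push_labelWith [DecidableEq S] (s₀ : S) (x : V → ℝ) :
    push Prod.fst (labelWith s₀ x) = x := by
  ext v
  unfold push
  rw [finsum_eq_single _ (v, s₀)]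
  · simp [labelWith]
  · rintro ⟨v', s⟩ hne
    by_cases hv : v' = v
    · have : s ≠ s₀ := fun h => hne (by rw [hv, h])
      simp [labelWith, this]
    · simp [hv]

theorem fillsSphere_of_labeled [Nonempty S] {K : ASC V} {j : ℕ}
    (h : FillsSphere j (labeled K S).space) : FillsSphere j K.space := by
  classical
  exact h.of_retract (i := labelWith (Classical.arbitrary S)) (r := push Prod.fst)
    (continuous_labelWith _).continuousOn (continuousOn_push _ _)
    (fun x hx => restrict_space_subset _ _ (labelWith_mem _ hx)) (fun y hy => push_fst_mem hy)
    fun x _ => push_labelWith _ x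

end ASC

/-- If `X` is `n`-connected and the link of each `k`-simplex of `X` is `(n−k−1)`-connected,
then the labeled complex `X^S` is `n`-connected; conversely if `X^S` is `n`-connected then so
is `X`. -/
theorem labeled_connectivity {V S : Type} [DecidableEq V] [Nonempty S]
    (K : ASC V) (n : ℤ) :
    ((IsConn (↥K.space) n ∧ ∀ s ∈ K.faces, IsConn (↥(K.link s).space) (n - s.card)) →
        IsConn (↥(labeled K S).space) n) ∧
      (IsConn (↥(labeled K S).space) n → IsConn (↥K.space) n) := by
  constructor
  · rintro ⟨hK, hlink⟩
    rw [isConn_iff_fillsSphere] at hK ⊢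
    intro j hj
    have hn : ((n + 1).toNat : ℤ) = n + 1 := Int.toNat_of_nonneg (by omega)
    refine ASC.fillsSphere_labeled (n := (n + 1).toNat) (fun i hi => hK i (by omega))
      (fun s hs i hi => ?_) (by omega)
    exact isConn_iff_fillsSphere.1 (hlink s hs) i (by omega)
  · intro h
    rw [isConn_iff_fillsSphere] at h ⊢
    exact fun j hj => ASC.fillsSphere_of_labeled (h j hj)
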